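/- Let (R, m) be a Noetherian local ring and M a finitely generated R-module admitting a canonical module ω_M (i.e. a finitely generated R-module whose Matlis dual Hom_R(ω_M, E(R/m)) is isomorphic to H_m^{dim M}(M)). Then Ass_R(ω_M) = { p ∈ Ass_R(M) : dim(R/p) = dim M }. In particular dim ω_M = dim M and Supp_R(ω_M) ⊆ Supp_R(M). -/

import Mathlib

open CategoryTheory IsLocalRing Pointwise

noncomputable section

/-- `E` is an injective hull of `S ⧸ J` over `S`. -/
def IsInjHull (S : Type) [CommRing S] (J : Ideal S) (E : Type) [AddCommGroup E]
    [Module S E] : Prop :=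
  Module.Injective S E ∧
    ∃ f : (S ⧸ J) →ₗ[S] E, Function.Injective f ∧
      ∀ N : Submodule S E, N ≠ ⊥ → N ⊓ LinearMap.range f ≠ ⊥

/-- Local cohomology `H^i_J(M)`. -/
abbrev LC (S : Type) [CommRing S] (J : Ideal S) (i : ℕ) (M : ModuleCat S) : ModuleCat S :=
  (localCohomology J i).obj M

/-- Krull dimension of a module (dimension of its support). -/
def mdim (S : Type) [CommRing S] (M : Type) [AddCommGroup M] [Module S M] : WithBot ℕ∞ :=
  Order.krullDim (Module.support S M)

/-- Depth/grade of an ideal `J` on `M`: supremum of lengths of `M`-regular sequences in `J`. -/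
def gradeI (S : Type) [CommRing S] (J : Ideal S) (M : Type) [AddCommGroup M]
    [Module S M] : ℕ∞ :=
  sSup {n : ℕ∞ | ∃ rs : List S, (rs.length : ℕ∞) = n ∧ (∀ r ∈ rs, r ∈ J) ∧
    RingTheory.Sequence.IsRegular M rs}

/-- The local "height" of `M` at a prime `p`, i.e. `dim_{S_p} M_p`. -/
def htM (S : Type) [CommRing S] (M : Type) [AddCommGroup M] [Module S M]
    (p : PrimeSpectrum S) : WithBot ℕ∞ :=
  mdim (Localization.AtPrime p.asIdeal) (LocalizedModule p.asIdeal.primeCompl M)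

/-- `ht_M(a) = inf { dim_{S_p} M_p : p ⊇ a, p ∈ Supp M }`. -/
def htI (S : Type) [CommRing S] (M : Type) [AddCommGroup M] [Module S M]
    (a : Ideal S) : WithBot ℕ∞ :=
  sInf {d | ∃ p ∈ Module.support S M, a ≤ p.asIdeal ∧ d = htM S M p}

/-- Serre's condition `S_n` for the module `M`. -/
def Serre (S : Type) [CommRing S] (n : ℕ) (M : Type) [AddCommGroup M] [Module S M] : Prop :=
  ∀ (p : Ideal S) [p.IsPrime],
    min (n : WithBot ℕ∞)
        (mdim (Localization.AtPrime p) (LocalizedModule p.primeCompl M)) ≤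
      (gradeI (Localization.AtPrime p) (IsLocalRing.maximalIdeal (Localization.AtPrime p))
        (LocalizedModule p.primeCompl M) : ℕ∞)

/-- Attached primes of `M` (Macdonald): primes of the form `Ann(M ⧸ N)`. -/
def attachedPrimes (S : Type) [CommRing S] (M : Type) [AddCommGroup M] [Module S M] :
    Set (Ideal S) :=
  {p | p.IsPrime ∧ ∃ N : Submodule S M, p = Module.annihilator S (M ⧸ N)}

/-- `ω` is a canonical module of the `d`-dimensional module `M` over `(S, J)`:
its "Matlis dual" `Hom_S(ω, E)` is isomorphic to `H^d_J(M)`. -/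
def IsCanonicalModule (S : Type) [CommRing S] (J : Ideal S) (d : ℕ)
    (M ω : ModuleCat S) : Prop :=
  Module.Finite S ω ∧ ∃ E : ModuleCat S, IsInjHull S J ↥E ∧
    Nonempty ((↥ω →ₗ[S] ↥E) ≃ₗ[S] ↥(LC S J d M))

/-- `(S, J)` is quasi-Gorenstein: `H^d_J(S)` is an injective hull of `S ⧸ J`, `d = dim S`. -/
def IsQuasiGorensteinAt (S : Type) [CommRing S] (J : Ideal S) : Prop :=
  ∃ d : ℕ, ringKrullDim S = (d : WithBot ℕ∞) ∧
    ∃ E : ModuleCat S, IsInjHull S J ↥E ∧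
      Nonempty (↥(LC S J d (ModuleCat.of S S)) ≃ₗ[S] ↥E)

/-- Totally reflexive modules. -/
def TotallyReflexive (S : Type) [CommRing S] (M : ModuleCat S) : Prop :=
  Module.Finite S ↥M ∧ Module.IsReflexive S ↥M ∧
    ∀ i : ℕ, 0 < i →
      Subsingleton ↥(((Ext S (ModuleCat S) i).obj (Opposite.op M)).obj (ModuleCat.of S S)) ∧
      Subsingleton ↥(((Ext S (ModuleCat S) i).obj
        (Opposite.op (ModuleCat.of S (Module.Dual S ↥M)))).obj (ModuleCat.of S S))

/-- `G`-dimension at most `n`. -/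
def GdimLE (S : Type) [CommRing S] : ℕ → ModuleCat S → Prop
  | 0, M => TotallyReflexive S M
  | n + 1, M => ∃ (G : ModuleCat S) (f : ↥G →ₗ[S] ↥M), Function.Surjective f ∧
      TotallyReflexive S G ∧ GdimLE S n (ModuleCat.of S (LinearMap.ker f))

/-- Injective dimension at most `n`. -/
def InjDimLE (S : Type) [CommRing S] : ℕ → ModuleCat S → Prop
  | 0, M => Module.Injective S ↥M
  | n + 1, M => ∃ (E : ModuleCat S) (f : ↥M →ₗ[S] ↥E), Function.Injective f ∧
      Module.Injective S ↥E ∧ InjDimLE S n (ModuleCat.of S (↥E ⧸ LinearMap.range f))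

/-- Injective dimension, as an element of `ℕ∞`. -/
def injDim (S : Type) [CommRing S] (M : ModuleCat S) : ℕ∞ :=
  sInf {n : ℕ∞ | ∃ k : ℕ, (k : ℕ∞) = n ∧ InjDimLE S k M}

/-- Minimal number of generators. -/
def genNumber (S : Type) [CommRing S] (M : Type) [AddCommGroup M] [Module S M] : ℕ∞ :=
  sInf {n : ℕ∞ | ∃ s : Finset M, (s.card : ℕ∞) = n ∧ Submodule.span S (↑s : Set M) = ⊤}

/-- The socle `0 :_M J`. -/
def socle (S : Type) [CommRing S] (J : Ideal S) (M : Type) [AddCommGroup M] [Module S M] :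
    Submodule S M :=
  ⨅ r ∈ J, LinearMap.ker (LinearMap.lsmul S M r)

/-- Limit closure of the sequence `x` on `M`. -/
def limClo (S : Type) [CommRing S] {v : ℕ} (x : Fin v → S) (M : Type) [AddCommGroup M]
    [Module S M] : Submodule S M :=
  ⨆ t : ℕ, (Ideal.span (Set.range fun i => x i ^ (t + 1)) • (⊤ : Submodule S M)).comap
      (LinearMap.lsmul S M ((∏ i, x i) ^ t))

end

/-- Krull dimension of a ring, valued in `WithBot ℕ∞`. -/
noncomputable def rdim (S : Type) [CommRing S] : WithBot ℕ∞ :=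
  Order.krullDim (PrimeSpectrum S)

noncomputable section

namespace ExtComparison

variable {R : Type} [CommRing R] {X X' : ModuleCat.{0} R}

/-- Precomposition with a chain map, as a map of `Hom` complexes. -/
def homComplexMap {P P' : ChainComplex (ModuleCat.{0} R) ℕ} (φ : P' ⟶ P) (Y : ModuleCat.{0} R) :
    P.linearYonedaObj R Y ⟶ P'.linearYonedaObj R Y :=
  (HomologicalComplex.unopFunctor _ _).map
    ((((linearYoneda R (ModuleCat.{0} R)).obj Y).rightOp.mapHomologicalComplex _).map φ).op

lemma homologyUnop_inv_naturality {V : Type*} [Category* V] [Abelian V] {ι : Type*}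
    {c : ComplexShape ι} {K L : HomologicalComplex Vᵒᵖ c} (φ : K ⟶ L) (i : ι) :
    (HomologicalComplex.homologyMap φ i).unop ≫ (K.homologyUnop i).inv =
      (L.homologyUnop i).inv ≫
        HomologicalComplex.homologyMap ((HomologicalComplex.unopFunctor V c).map φ.op) i := by
  have := ShortComplex.homologyOpIso_inv_naturality
    ((HomologicalComplex.shortComplexFunctor V c.symm i).map
      ((HomologicalComplex.unopFunctor V c).map φ.op))
  exact (congrArg Quiver.Hom.unop this).symm

lemma comp_square_comp_square {C : Type*} [Category* C] {A A' B B' D D' : C} {e : A ⟶ A'}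
    {p : A ⟶ B} {p' : A' ⟶ B'} {m : B ⟶ B'} {u : B ⟶ D} {u' : B' ⟶ D'} {h : D ⟶ D'}
    (h₁ : e ≫ p' = p ≫ m) (h₂ : m ≫ u' = u ≫ h) : e ≫ (p' ≫ u') = (p ≫ u) ≫ h := by
  rw [reassoc_of% h₁, h₂, Category.assoc]

lemma isoExt_hom_naturality (g : X' ⟶ X) (P : ProjectiveResolution X)
    (P' : ProjectiveResolution X') (φ : P'.complex ⟶ P.complex)
    (hφ : φ.f 0 ≫ P.π.f 0 = P'.π.f 0 ≫ g) (n : ℕ) (Y : ModuleCat.{0} R) :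
    ((Ext R (ModuleCat.{0} R) n).map g.op).app Y ≫ (P'.isoExt n Y).hom =
      (P.isoExt n Y).hom ≫ HomologicalComplex.homologyMap (homComplexMap φ Y) n := by
  exact comp_square_comp_square
    (congrArg Quiver.Hom.unop (P'.isoLeftDerivedObj_inv_naturality g P φ hφ
      ((linearYoneda R (ModuleCat.{0} R)).obj Y).rightOp n))
    (homologyUnop_inv_naturality
      ((((linearYoneda R (ModuleCat.{0} R)).obj Y).rightOp.mapHomologicalComplex _).map φ) n)

end ExtComparison

namespace ExtComparison
variable {R : Type} [CommRing R]

section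
variable (K : CochainComplex (ModuleCat.{0} R) ℕ) (n : ℕ)

/-- The cocycles of degree `n`, as a submodule. -/
def cocycles : Submodule R (K.X n) := LinearMap.ker (K.d n (n + 1)).hom

/-- Concrete cocycles map to abstract ones. -/
def toCycles : cocycles K n →ₗ[R] K.cycles n :=
  (K.liftCycles (ModuleCat.ofHom (cocycles K n).subtype) (n + 1) (by simp)
    (by ext f; exact f.2)).hom

/-- The cohomology class of a cocycle. -/
def cocyclesClass : cocycles K n →ₗ[R] K.homology n :=
  (K.homologyπ n).hom ∘ₗ toCycles K n

lemma iCycles_toCycles (f : cocycles K n) : (K.iCycles n).hom (toCycles K n f) = f.1 := by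
  rw [toCycles, ← LinearMap.comp_apply, ← ModuleCat.hom_comp, K.liftCycles_i]
  rfl

lemma iCycles_injective : Function.Injective (K.iCycles n).hom :=
  (ModuleCat.mono_iff_injective (K.iCycles n)).1 inferInstance

lemma cocyclesClass_surjective : Function.Surjective (cocyclesClass K n) := by
  intro c
  obtain ⟨z, rfl⟩ := (ModuleCat.epi_iff_surjective (K.homologyπ n)).1 inferInstance c
  have hz : (K.d n (n + 1)).hom ((K.iCycles n).hom z) = 0 := by
    rw [← LinearMap.comp_apply, ← ModuleCat.hom_comp, K.iCycles_d]; rfl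
  exact ⟨⟨(K.iCycles n).hom z, hz⟩,
    congrArg (K.homologyπ n).hom (iCycles_injective K n (iCycles_toCycles K n _))⟩

lemma cocyclesClass_eq_zero_iff {p : ℕ} (hp : (ComplexShape.up ℕ).prev n = p)
    (f : cocycles K n) : cocyclesClass K n f = 0 ↔ ∃ g, (K.d p n).hom g = f.1 := by
  have hex : (ShortComplex.mk _ _ (K.toCycles_comp_homologyπ p n)).Exact :=
    ShortComplex.exact_of_g_is_cokernel _ (K.homologyIsCokernel p n hp)
  rw [ShortComplex.moduleCat_exact_iff] at hex
  have key (g : K.X p) : (K.iCycles n).hom ((K.toCycles p n).hom g) = (K.d p n).hom g := by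
    rw [← LinearMap.comp_apply, ← ModuleCat.hom_comp, K.toCycles_i]
  constructor
  · intro h
    obtain ⟨g, hg⟩ := hex _ h
    exact ⟨g, (key g).symm.trans ((congrArg (K.iCycles n).hom hg).trans (iCycles_toCycles K n f))⟩
  · rintro ⟨g, hg⟩
    have : (K.toCycles p n).hom g = toCycles K n f :=
      iCycles_injective K n ((key g).trans (hg.trans (iCycles_toCycles K n f).symm))
    rw [cocyclesClass, LinearMap.comp_apply, ← this, ← LinearMap.comp_apply, ← ModuleCat.hom_comp,
      K.toCycles_comp_homologyπ]
    rfl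

variable {K} in
lemma cocyclesClass_naturality {L : CochainComplex (ModuleCat.{0} R) ℕ} (φ : K ⟶ L)
    (f : cocycles K n) (h) :
    (HomologicalComplex.homologyMap φ n).hom (cocyclesClass K n f) =
      cocyclesClass L n ⟨(φ.f n).hom f, h⟩ := by
  have : (HomologicalComplex.cyclesMap φ n).hom (toCycles K n f) =
      toCycles L n ⟨(φ.f n).hom f, h⟩ := by
    apply iCycles_injective
    rw [iCycles_toCycles, ← LinearMap.comp_apply, ← ModuleCat.hom_comp,
      HomologicalComplex.cyclesMap_i, ModuleCat.hom_comp, LinearMap.comp_apply, iCycles_toCycles]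
  rw [cocyclesClass, LinearMap.comp_apply, ← LinearMap.comp_apply, ← ModuleCat.hom_comp,
    HomologicalComplex.homologyπ_naturality, ModuleCat.hom_comp, LinearMap.comp_apply, this]
  rfl
end

section
variable {X X' : ModuleCat.{0} R} (P : ProjectiveResolution X) (n : ℕ) (Y : ModuleCat.{0} R)

open Abelian CochainComplex HomComplex Limits

abbrev homCocycles := cocycles (P.complex.linearYonedaObj R Y) n

/-- The underlying morphism of a cocycle. -/
abbrev homOf (f : homCocycles P n Y) : P.complex.X n ⟶ Y := f.1

lemma d_homOf (f : homCocycles P n Y) : P.complex.d (n + 1) n ≫ homOf P n Y f = 0 := f.2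

def newClass : homCocycles P n Y →ₗ[R] Ext X Y n where
  toFun f := P.extMk (homOf P n Y f) (n + 1) rfl (d_homOf P n Y f)
  map_add' f g := (P.add_extMk _ _ _ _ _ _).symm
  map_smul' r f := by
    rw [Ext.smul_eq_comp_mk₀, P.extMk_comp_mk₀]
    congr 1

lemma newClass_surjective : Function.Surjective (newClass P n Y) := by
  intro α
  obtain ⟨f, hf, rfl⟩ := P.extMk_surjective α (n + 1) rfl
  exact ⟨⟨f, hf⟩, rfl⟩

lemma newClass_eq_zero_iff (f : homCocycles P n Y) : newClass P n Y f = 0 ↔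
    cocyclesClass _ n f = 0 := by
  cases n with
  | zero =>
    rw [cocyclesClass_eq_zero_iff _ _ (p := 0) (by simp)]
    have hd : (P.complex.linearYonedaObj R Y).d 0 0 = 0 := HomologicalComplex.shape _ _ _ (by simp)
    have : newClass P 0 Y f = 0 ↔ homOf P 0 Y f = 0 := by
      show P.extMk (homOf P 0 Y f) (0 + 1) rfl (d_homOf P 0 Y f) = 0 ↔ _
      rw [← P.extEquivCohomologyClass.apply_eq_iff_eq, P.extEquivCohomologyClass_extMk,
        P.extEquivCohomologyClass_zero, CohomologyClass.mk_eq_zero_iff,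
        Cocycle.toSingleMk_mem_coboundaries_iff _ _ _ _ _ 1 (by simp)]
      have hd' : P.cochainComplex.d (-(0 : ℕ)) 1 = 0 := by
        exact (P.cochainComplex.isZero_of_isStrictlyLE 0 1 (by simp)).eq_of_tgt _ _
      rw [hd']
      simp only [zero_comp]
      exact ⟨fun ⟨_, h⟩ ↦ (cancel_epi (P.cochainComplexXIso (-(0 : ℕ)) 0 rfl).hom).1
        (by simpa using h.symm), fun h ↦ ⟨0, by simp [h]⟩⟩
    rw [this, hd]
    exact ⟨fun h ↦ ⟨0, h.symm⟩, fun ⟨_, h⟩ ↦ h.symm⟩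
  | succ p =>
    rw [cocyclesClass_eq_zero_iff _ _ (p := p) (by simp)]
    exact P.extMk_eq_zero_iff (homOf P _ Y f) _ rfl (d_homOf P _ Y f) p rfl

def oldClass : homCocycles P n Y →ₗ[R]
    ((_root_.Ext R (ModuleCat.{0} R) n).obj (Opposite.op X)).obj Y :=
  (P.isoExt n Y).inv.hom ∘ₗ cocyclesClass _ n

lemma oldClass_surjective : Function.Surjective (oldClass P n Y) :=
  ((P.isoExt n Y).symm.toLinearEquiv.surjective).comp (cocyclesClass_surjective _ n)

lemma oldClass_eq_zero_iff (f : homCocycles P n Y) : oldClass P n Y f = 0 ↔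
    cocyclesClass _ n f = 0 :=
  (P.isoExt n Y).symm.toLinearEquiv.map_eq_zero_iff

lemma ker_oldClass : LinearMap.ker (oldClass P n Y) = LinearMap.ker (newClass P n Y) := by
  ext f
  rw [LinearMap.mem_ker, LinearMap.mem_ker, oldClass_eq_zero_iff, newClass_eq_zero_iff]

/-- The two models of `Ext` agree. -/
def extEquivOf : ((_root_.Ext R (ModuleCat.{0} R) n).obj (Opposite.op X)).obj Y ≃ₗ[R]
    Abelian.Ext X Y n :=
  ((oldClass P n Y).quotKerEquivOfSurjective (oldClass_surjective P n Y)).symm ≪≫ₗ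
    Submodule.quotEquivOfEq _ _ (ker_oldClass P n Y) ≪≫ₗ
    (newClass P n Y).quotKerEquivOfSurjective (newClass_surjective P n Y)

lemma extEquivOf_oldClass (f : homCocycles P n Y) :
    extEquivOf P n Y (oldClass P n Y f) = newClass P n Y f := by
  have : ((oldClass P n Y).quotKerEquivOfSurjective (oldClass_surjective P n Y)).symm
      (oldClass P n Y f) = Submodule.Quotient.mk f := by
    rw [LinearEquiv.symm_apply_eq]; rfl
  exact congrArg (fun x ↦ (newClass P n Y).quotKerEquivOfSurjective (newClass_surjective P n Y)
    (Submodule.quotEquivOfEq _ _ (ker_oldClass P n Y) x)) this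

variable {P}

/-- Pulling back cocycles along a chain map. -/
def pullCocycle {P' : ProjectiveResolution X'} (φ : P'.complex ⟶ P.complex)
    (f : homCocycles P n Y) : homCocycles P' n Y :=
  ⟨φ.f n ≫ homOf P n Y f, by
    show P'.complex.d (n + 1) n ≫ φ.f n ≫ homOf P n Y f = 0
    rw [← φ.comm_assoc, d_homOf, comp_zero]⟩

lemma map_oldClass {P' : ProjectiveResolution X'} {g : X' ⟶ X} (φ : P'.complex ⟶ P.complex)
    (hφ : φ.f 0 ≫ P.π.f 0 = P'.π.f 0 ≫ g) (f : homCocycles P n Y) :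
    (((_root_.Ext R (ModuleCat.{0} R) n).map g.op).app Y).hom (oldClass P n Y f) =
      oldClass P' n Y (pullCocycle n Y φ f) := by
  apply (P'.isoExt n Y).toLinearEquiv.injective
  refine (LinearMap.congr_fun (congrArg ModuleCat.Hom.hom
    (isoExt_hom_naturality g P P' φ hφ n Y)) (oldClass P n Y f)).trans ?_
  refine (congrArg (HomologicalComplex.homologyMap (homComplexMap φ Y) n).hom
    ((P.isoExt n Y).toLinearEquiv.apply_symm_apply _)).trans ?_
  refine (cocyclesClass_naturality n (homComplexMap φ Y) f (pullCocycle n Y φ f).2).trans ?_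
  exact ((P'.isoExt n Y).toLinearEquiv.apply_symm_apply _).symm

lemma extEquivOf_naturality {P' : ProjectiveResolution X'} {g : X' ⟶ X}
    (φ : ProjectiveResolution.Hom P' P g)
    (c : ((_root_.Ext R (ModuleCat.{0} R) n).obj (Opposite.op X)).obj Y) :
    extEquivOf P' n Y ((((_root_.Ext R (ModuleCat.{0} R) n).map g.op).app Y).hom c) =
      (Ext.mk₀ g).comp (extEquivOf P n Y c) (zero_add _) := by
  obtain ⟨f, rfl⟩ := oldClass_surjective P n Y c
  rw [map_oldClass (g := g) n Y φ.hom φ.hom_f_zero_comp_π_f_zero, extEquivOf_oldClass,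
    extEquivOf_oldClass]
  exact (P.mk₀_comp_extMk (homOf P n Y f) (n + 1) rfl (d_homOf P n Y f) φ).symm

variable (X) in
/-- The two models of `Ext` agree. -/
def extEquiv : ((_root_.Ext R (ModuleCat.{0} R) n).obj (Opposite.op X)).obj Y ≃ₗ[R]
    Abelian.Ext X Y n :=
  extEquivOf (projectiveResolution X) n Y

lemma extEquiv_naturality (g : X' ⟶ X)
    (c : ((_root_.Ext R (ModuleCat.{0} R) n).obj (Opposite.op X)).obj Y) :
    extEquiv X' n Y ((((_root_.Ext R (ModuleCat.{0} R) n).map g.op).app Y).hom c) =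
      (Ext.mk₀ g).comp (extEquiv X n Y c) (zero_add _) :=
  extEquivOf_naturality n Y ⟨ProjectiveResolution.lift g _ _,
    ProjectiveResolution.lift_commutes_zero g _ _⟩ c

end

end ExtComparison

namespace LocalCoh

variable {R : Type} [CommRing R] (J : Ideal R)

/-- The module `R ⧸ J ^ t` as an object. -/
abbrev quo (t : ℕ) : ModuleCat.{0} R := ModuleCat.of R (R ⧸ J ^ t)

/-- The projection `R ⧸ J ^ t ⟶ R ⧸ J ^ s` for `s ≤ t`. -/
def quoMap {s t : ℕ} (h : s ≤ t) : quo J t ⟶ quo J s :=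
  ModuleCat.ofHom (Submodule.mapQ _ _ LinearMap.id (Ideal.pow_le_pow_right h))

lemma quoMap_self (s : ℕ) : quoMap J (le_refl s) = 𝟙 _ := by
  ext; rfl

lemma quoMap_comp {s t u : ℕ} (h : s ≤ t) (h' : t ≤ u) :
    quoMap J h' ≫ quoMap J h = quoMap J (h.trans h') := by
  ext; rfl

/-- The directed system computing local cohomology. -/
def trans (i : ℕ) (M : ModuleCat.{0} R) (s t : ℕ) (h : s ≤ t) :
    Abelian.Ext (quo J s) M i →ₗ[R] Abelian.Ext (quo J t) M i :=
  (Abelian.Ext.mk₀ (quoMap J h)).precompOfLinear R M (zero_add i)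

lemma trans_apply (i : ℕ) (M : ModuleCat.{0} R) {s t : ℕ} (h : s ≤ t)
    (x : Abelian.Ext (quo J s) M i) :
    trans J i M s t h x = (Abelian.Ext.mk₀ (quoMap J h)).comp x (zero_add i) := rfl

instance (i : ℕ) (M : ModuleCat.{0} R) : DirectedSystem
    (fun t ↦ Abelian.Ext (quo J t) M i) fun s t h ↦ trans J i M s t h where
  map_self s x := by
    rw [trans_apply, quoMap_self, Abelian.Ext.mk₀_id_comp]
  map_map _ _ _ h h' x := by
    rw [trans_apply, trans_apply, trans_apply, Abelian.Ext.mk₀_comp_mk₀_assoc, quoMap_comp]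

/-- Local cohomology as a concrete direct limit. -/
abbrev H (i : ℕ) (M : ModuleCat.{0} R) : Type :=
  Module.DirectLimit (fun t ↦ Abelian.Ext (quo J t) M i) (trans J i M)

/-- The structure maps of the direct limit. -/
abbrev H.of (i : ℕ) (M : ModuleCat.{0} R) (t : ℕ) : Abelian.Ext (quo J t) M i →ₗ[R] H J i M :=
  Module.DirectLimit.of R ℕ _ (trans J i M) t

variable {J} in
lemma H.exists_of {i : ℕ} {M : ModuleCat.{0} R} (z : H J i M) : ∃ t x, H.of J i M t x = z :=
  Module.DirectLimit.exists_of z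

variable {J} in
lemma H.of_trans {i : ℕ} {M : ModuleCat.{0} R} {s t : ℕ} (h : s ≤ t)
    (x : Abelian.Ext (quo J s) M i) :
    H.of J i M t ((Abelian.Ext.mk₀ (quoMap J h)).comp x (zero_add i)) = H.of J i M s x :=
  Module.DirectLimit.of_f

variable {J} in
lemma H.of_eq_zero {i : ℕ} {M : ModuleCat.{0} R} {s : ℕ} {x : Abelian.Ext (quo J s) M i}
    (hx : H.of J i M s x = 0) :
    ∃ t, ∃ h : s ≤ t, (Abelian.Ext.mk₀ (quoMap J h)).comp x (zero_add i) = 0 :=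
  Module.DirectLimit.of.zero_exact hx

section
open Abelian
/-- Composition with an `Ext` class on local cohomology. -/
def H.comp {M N : ModuleCat.{0} R} {n : ℕ} (β : Ext M N n) {a b : ℕ} (h : a + n = b) :
    H J a M →ₗ[R] H J b N :=
  Module.DirectLimit.map (fun t ↦ β.postcompOfLinear R (quo J t) h) fun s t hst ↦ by
    ext x
    exact Ext.comp_assoc _ _ _ (zero_add a) h (by lia)

@[simp]
lemma H.comp_of {M N : ModuleCat.{0} R} {n : ℕ} (β : Ext M N n) {a b : ℕ} (h : a + n = b) (t : ℕ)
    (x : Ext (quo J t) M a) : H.comp J β h (H.of J a M t x) = H.of J b N t (x.comp β h) :=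
  Module.DirectLimit.map_apply_of _ _ _

variable {M N P : ModuleCat.{0} R}

/-- Local cohomology of a linear map. -/
def H.map (i : ℕ) (f : M ⟶ N) : H J i M →ₗ[R] H J i N := H.comp J (Ext.mk₀ f) (add_zero i)

@[simp]
lemma H.map_of {i : ℕ} (f : M ⟶ N) (t : ℕ) (x : Ext (quo J t) M i) :
    H.map J i f (H.of J i M t x) = H.of J i N t (x.comp (Ext.mk₀ f) (add_zero i)) :=
  H.comp_of J _ _ t x

lemma H.map_comp {i : ℕ} (f : M ⟶ N) (g : N ⟶ P) (z : H J i M) :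
    H.map J i (f ≫ g) z = H.map J i g (H.map J i f z) := by
  obtain ⟨t, x, rfl⟩ := H.exists_of z
  simp

lemma H.map_smul_id (i : ℕ) (r : R) (z : H J i M) : H.map J i (r • 𝟙 M) z = r • z := by
  obtain ⟨t, x, rfl⟩ := H.exists_of z
  rw [H.map_of, ← Ext.smul_eq_comp_mk₀, LinearMap.map_smul]

lemma H.map_zero (i : ℕ) (z : H J i M) : H.map J i (0 : M ⟶ N) z = 0 := by
  obtain ⟨t, x, rfl⟩ := H.exists_of z
  simp

lemma H.exact₂ {f : M ⟶ N} {g : N ⟶ P} {w : f ≫ g = 0}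
    (hS : (ShortComplex.mk f g w).ShortExact) (i : ℕ) (z : H J i N)
    (hz : H.map J i g z = 0) : ∃ y, H.map J i f y = z := by
  obtain ⟨t, x, rfl⟩ := H.exists_of z
  rw [H.map_of] at hz
  obtain ⟨u, h, hu⟩ := H.of_eq_zero hz
  rw [← Ext.comp_assoc _ _ _ (zero_add i) (add_zero i) (by lia)] at hu
  obtain ⟨y, hy⟩ := Ext.covariant_sequence_exact₂ _ hS _ hu
  exact ⟨H.of J i _ u y, by rw [H.map_of, hy, H.of_trans]⟩

/-- The connecting map. -/
def H.δ {f : M ⟶ N} {g : N ⟶ P} {w : f ≫ g = 0}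
    (hS : (ShortComplex.mk f g w).ShortExact) (i : ℕ) :
    H J i P →ₗ[R] H J (i + 1) M := H.comp J hS.extClass rfl

lemma H.exact₃ {f : M ⟶ N} {g : N ⟶ P} {w : f ≫ g = 0}
    (hS : (ShortComplex.mk f g w).ShortExact) (i : ℕ) (z : H J i P)
    (hz : H.δ J hS i z = 0) : ∃ y, H.map J i g y = z := by
  obtain ⟨t, x, rfl⟩ := H.exists_of z
  rw [H.δ, H.comp_of] at hz
  obtain ⟨u, h, hu⟩ := H.of_eq_zero hz
  rw [← Ext.comp_assoc _ _ _ (zero_add i) rfl (by lia)] at hu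
  obtain ⟨y, hy⟩ := Ext.covariant_sequence_exact₃ _ hS _ rfl hu
  exact ⟨H.of J i _ u y, by rw [H.map_of, hy, H.of_trans]⟩

lemma H.exact₁ {f : M ⟶ N} {g : N ⟶ P} {w : f ≫ g = 0}
    (hS : (ShortComplex.mk f g w).ShortExact) (i : ℕ)
    (z : H J (i + 1) M)
    (hz : H.map J (i + 1) f z = 0) : ∃ y, H.δ J hS i y = z := by
  obtain ⟨t, x, rfl⟩ := H.exists_of z
  rw [H.map_of] at hz
  obtain ⟨u, h, hu⟩ := H.of_eq_zero hz
  rw [← Ext.comp_assoc _ _ _ (zero_add _) (add_zero _) (by lia)] at hu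
  obtain ⟨y, hy⟩ := Ext.covariant_sequence_exact₁ _ hS _ hu rfl
  exact ⟨H.of J i _ u y, by rw [H.δ, H.comp_of, hy, H.of_trans]⟩

lemma H.map_f_δ {f : M ⟶ N} {g : N ⟶ P} {w : f ≫ g = 0}
    (hS : (ShortComplex.mk f g w).ShortExact) (i : ℕ) (z : H J i N) :
    H.δ J hS i (H.map J i g z) = 0 := by
  obtain ⟨t, x, rfl⟩ := H.exists_of z
  rw [H.map_of, H.δ, H.comp_of, Ext.comp_assoc _ _ _ (add_zero _) (zero_add 1) (by lia),
    hS.comp_extClass, Ext.comp_zero, LinearMap.map_zero]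

lemma H.map_δ {f : M ⟶ N} {g : N ⟶ P} {w : f ≫ g = 0}
    (hS : (ShortComplex.mk f g w).ShortExact) (i : ℕ) (z : H J i P) :
    H.map J (i + 1) f (H.δ J hS i z) = 0 := by
  obtain ⟨t, x, rfl⟩ := H.exists_of z
  rw [H.δ, H.comp_of, H.map_of, Ext.comp_assoc _ _ _ rfl (add_zero 1) (by lia),
    hS.extClass_comp, Ext.comp_zero, LinearMap.map_zero]

lemma H.eq_zero_of_injective [Injective M] (i : ℕ) (z : H J (i + 1) M) : z = 0 := by
  obtain ⟨t, x, rfl⟩ := H.exists_of z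
  rw [x.eq_zero_of_injective, LinearMap.map_zero]

lemma H.torsion {i : ℕ} (z : H J i M) : ∃ t, ∀ r ∈ J ^ t, r • z = 0 := by
  obtain ⟨t, x, rfl⟩ := H.exists_of z
  refine ⟨t, fun r hr ↦ ?_⟩
  have h0 : r • 𝟙 (quo J t) = 0 := by
    ext
    show r • Ideal.Quotient.mk (J ^ t) 1 = 0
    rw [← Ideal.Quotient.mk_eq_mk, ← Submodule.Quotient.mk_smul, Submodule.Quotient.mk_eq_zero]
    simpa using hr
  have : r • x = (r • Ext.mk₀ (𝟙 (quo J t))).comp x (zero_add i) := by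
    rw [Ext.smul_comp, Ext.mk₀_id_comp]
  rw [← LinearMap.map_smul, this, ← Ext.mk₀_smul, h0]
  simp

/-- Evaluation of a degree zero class at the unit. -/
def evalOne (M : ModuleCat.{0} R) (t : ℕ) : Ext (quo J t) M 0 →ₗ[R] M where
  toFun x := (Ext.addEquiv₀ x).hom (Ideal.Quotient.mk _ 1)
  map_add' := by intros; simp
  map_smul' r x := by
    obtain ⟨f, rfl⟩ := Ext.addEquiv₀.symm.surjective x
    have : r • Ext.addEquiv₀.symm f = Ext.addEquiv₀.symm (r • f) := (Ext.mk₀_smul r f).symm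
    rw [this, AddEquiv.apply_symm_apply, AddEquiv.apply_symm_apply]
    rfl

lemma evalOne_mk₀ (t : ℕ) (f : quo J t ⟶ M) :
    evalOne J M t (Ext.mk₀ f) = f.hom (Ideal.Quotient.mk _ 1) := by
  show (Ext.addEquiv₀ (Ext.addEquiv₀.symm f)).hom _ = _
  rw [AddEquiv.apply_symm_apply]

/-- Evaluation at the unit, from local cohomology in degree zero. -/
def H.ev (M : ModuleCat.{0} R) : H J 0 M →ₗ[R] M :=
  Module.DirectLimit.lift R ℕ _ _ (evalOne J M) (by
    intro s t h x
    obtain ⟨f, rfl⟩ := Ext.addEquiv₀.symm.surjective x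
    have : trans J 0 M s t h (Ext.mk₀ f) = Ext.mk₀ (quoMap J h ≫ f) := Ext.mk₀_comp_mk₀ _ _
    refine (congrArg _ this).trans ?_
    rw [evalOne_mk₀]
    exact (evalOne_mk₀ J s f).symm)

lemma H.ev_of (t : ℕ) (f : quo J t ⟶ M) :
    H.ev J M (H.of J 0 M t (Ext.mk₀ f)) = f.hom (Ideal.Quotient.mk _ 1) := by
  rw [H.ev]
  refine (Module.DirectLimit.lift_of _ _ _).trans ?_
  rw [evalOne_mk₀]

lemma H.exists_of₀ (z : H J 0 M) : ∃ t f, H.of J 0 M t (Ext.mk₀ f) = z := by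
  obtain ⟨t, x, rfl⟩ := H.exists_of z
  exact ⟨t, Ext.addEquiv₀ x, by rw [Ext.mk₀_addEquiv₀_apply]⟩

lemma H.ev_map (f : M ⟶ N) (z : H J 0 M) : H.ev J N (H.map J 0 f z) = f.hom (H.ev J M z) := by
  obtain ⟨t, g, rfl⟩ := H.exists_of₀ J z
  rw [H.map_of, Ext.mk₀_comp_mk₀, H.ev_of, H.ev_of]
  rfl

lemma H.ev_injective (M : ModuleCat.{0} R) : Function.Injective (H.ev J M) := by
  rw [← LinearMap.ker_eq_bot, LinearMap.ker_eq_bot']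
  intro z hz
  obtain ⟨t, g, rfl⟩ := H.exists_of₀ J z
  rw [H.ev_of] at hz
  have : g = 0 := by
    ext
    exact hz
  rw [this, Ext.mk₀_zero, LinearMap.map_zero]

lemma H.exists_ev (t : ℕ) (a : M) (ha : ∀ r ∈ J ^ t, r • a = 0) : ∃ z, H.ev J M z = a :=
  ⟨H.of J 0 M t (Ext.mk₀ (ModuleCat.ofHom ((J ^ t).liftQ (LinearMap.toSpanSingleton R M a)
    fun r hr ↦ ha r hr))), by
    rw [H.ev_of]
    show (1 : R) • a = a
    simp⟩

end
end LocalCoh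

namespace LocalCoh
open Limits Opposite localCohomology ExtComparison
variable {R : Type} [CommRing R] (J : Ideal R) (i : ℕ) (M : ModuleCat.{0} R)

/-- The structure maps of Mathlib's local cohomology. -/
def lcι (t : ℕ) :
    ((_root_.Ext R (ModuleCat.{0} R) i).obj (op (quo J t))).obj M →ₗ[R]
      (localCohomology J i).obj M :=
  ((colimit.ι (diagram (idealPowersDiagram J) i) (op (op t))).app M).hom

/-- The cocone of local cohomology evaluated at `M`. -/
def lcIsColimit : IsColimit (((evaluation (ModuleCat.{0} R) (ModuleCat.{0} R)).obj M).mapCocone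
    (colimit.cocone (diagram (idealPowersDiagram J) i))) :=
  isColimitOfPreserves _ (colimit.isColimit _)

lemma lcι_trans {s t : ℕ} (h : s ≤ t)
    (x : ((_root_.Ext R (ModuleCat.{0} R) i).obj (op (quo J s))).obj M) :
    lcι J i M t ((((_root_.Ext R (ModuleCat.{0} R) i).map (quoMap J h).op).app M).hom x) =
      lcι J i M s x :=
  LinearMap.congr_fun (congrArg (fun f ↦ (f.app M).hom)
    (colimit.w (diagram (idealPowersDiagram J) i) (homOfLE h).op.op)) x

lemma lcι_jointly_surjective (z : (localCohomology J i).obj M) : ∃ t x, lcι J i M t x = z := by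
  obtain ⟨t, x, hx⟩ := Concrete.isColimit_exists_rep _ (lcIsColimit J i M) z
  exact ⟨t.unop.unop, x, hx⟩

lemma lcι_eq_zero {s : ℕ} {x : ((_root_.Ext R (ModuleCat.{0} R) i).obj (op (quo J s))).obj M}
    (hx : lcι J i M s x = 0) : ∃ t, ∃ h : s ≤ t,
      (((_root_.Ext R (ModuleCat.{0} R) i).map (quoMap J h).op).app M).hom x = 0 := by
  obtain ⟨t, f, g, h⟩ := Concrete.isColimit_exists_of_rep_eq
    _ (lcIsColimit J i M) (i := op (op s)) (j := op (op s)) x 0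
    (hx.trans (LinearMap.map_zero (lcι J i M s)).symm)
  refine ⟨t.unop.unop, leOfHom f.unop.unop, h.trans ?_⟩
  exact LinearMap.map_zero (((diagram (idealPowersDiagram J) i).map g).app M).hom

/-- The comparison map. -/
def H.toLC : H J i M →ₗ[R] (localCohomology J i).obj M :=
  Module.DirectLimit.lift R ℕ _ _
    (fun t ↦ lcι J i M t ∘ₗ (extEquiv (quo J t) i M).symm.toLinearMap) (by
      intro s t h x
      obtain ⟨y, rfl⟩ := (extEquiv (quo J s) i M).surjective x
      rw [trans_apply, ← extEquiv_naturality]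
      simp only [LinearMap.comp_apply, LinearEquiv.coe_coe, LinearEquiv.symm_apply_apply]
      exact lcι_trans J i M h y)

lemma H.toLC_of (t : ℕ) (y) :
    H.toLC J i M (H.of J i M t (extEquiv (quo J t) i M y)) = lcι J i M t y := by
  refine (Module.DirectLimit.lift_of _ _ _).trans ?_
  simp

lemma H.toLC_bijective : Function.Bijective (H.toLC J i M) := by
  constructor
  · rw [← LinearMap.ker_eq_bot, LinearMap.ker_eq_bot']
    intro z hz
    obtain ⟨t, x, rfl⟩ := H.exists_of z
    obtain ⟨y, rfl⟩ := (extEquiv (quo J t) i M).surjective x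
    rw [H.toLC_of] at hz
    obtain ⟨u, h, hu⟩ := lcι_eq_zero J i M hz
    rw [← H.of_trans h, ← extEquiv_naturality, hu, LinearEquiv.map_zero, LinearMap.map_zero]
  · intro z
    obtain ⟨t, y, rfl⟩ := lcι_jointly_surjective J i M z
    exact ⟨_, H.toLC_of J i M t y⟩

/-- The concrete direct limit computes Mathlib's local cohomology. -/
def H.equivLC : H J i M ≃ₗ[R] (localCohomology J i).obj M :=
  LinearEquiv.ofBijective (H.toLC J i M) (H.toLC_bijective J i M)

end LocalCoh

namespace LocalCoh
open IsLocalRing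

section
variable {R : Type} [CommRing R] (J : Ideal R) (i : ℕ)
variable {M N P : Type} [AddCommGroup M] [Module R M] [AddCommGroup N] [Module R N]
  [AddCommGroup P] [Module R P]

variable (M) in
/-- Local cohomology of an unbundled module. -/
abbrev lc : Type := H J i (ModuleCat.of R M)

/-- Local cohomology of a linear map. -/
def lcMap (f : M →ₗ[R] N) : lc J i M →ₗ[R] lc J i N := H.map J i (ModuleCat.ofHom f)

lemma lcMap_comp (f : M →ₗ[R] N) (g : N →ₗ[R] P) (z : lc J i M) :
    lcMap J i (g ∘ₗ f) z = lcMap J i g (lcMap J i f z) :=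
  H.map_comp J (ModuleCat.ofHom f) (ModuleCat.ofHom g) z

lemma lcMap_lsmul (r : R) (z : lc J i M) : lcMap J i (LinearMap.lsmul R M r) z = r • z :=
  H.map_smul_id J i r z

lemma lcMap_zero (z : lc J i M) : lcMap J i (0 : M →ₗ[R] N) z = 0 := H.map_zero J i z

lemma lc_smul_eq_zero {r : R} (hr : ∀ a : M, r • a = 0) (z : lc J i M) : r • z = 0 := by
  have : LinearMap.lsmul R M r = 0 := LinearMap.ext hr
  rw [← lcMap_lsmul, this, lcMap_zero]

lemma lc_eq_zero_of_subsingleton [Subsingleton M] (z : lc J i M) : z = 0 := by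
  rw [← one_smul R z]
  exact lc_smul_eq_zero J i (fun a ↦ Subsingleton.elim _ _) z

lemma lc_torsion (z : lc J i M) : ∃ t, ∀ r ∈ J ^ t, r • z = 0 := H.torsion J z

lemma lc_eq_zero_of_injective [Module.Injective R M] (z : lc J (i + 1) M) : z = 0 :=
  have : Injective (ModuleCat.of R M) := Module.injective_object_of_injective_module R M
  H.eq_zero_of_injective J i z

/-- The long exact sequence in local cohomology, for a short complex. -/
lemma H.exists_exact {X Y Z : ModuleCat.{0} R} {f : X ⟶ Y} {g : Y ⟶ Z} {w : f ≫ g = 0}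
    (hS : (ShortComplex.mk f g w).ShortExact) :
    ∃ δ : H J i Z →ₗ[R] H J (i + 1) X,
      Function.Exact (H.map J i f) (H.map J i g) ∧ Function.Exact (H.map J i g) δ ∧
      Function.Exact δ (H.map J (i + 1) f) := by
  refine ⟨H.δ J hS i, fun z ↦ ⟨H.exact₂ J hS i z, fun h ↦ ?_⟩,
    fun z ↦ ⟨H.exact₃ J hS i z, fun h ↦ ?_⟩, fun z ↦ ⟨H.exact₁ J hS i z, fun h ↦ ?_⟩⟩
  · obtain ⟨y, hy⟩ := h
    rw [← hy, ← H.map_comp, w, H.map_zero]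
  · obtain ⟨y, hy⟩ := h
    rw [← hy]
    exact H.map_f_δ J hS i y
  · obtain ⟨y, hy⟩ := h
    rw [← hy]
    exact H.map_δ J hS i y

/-- The long exact sequence in local cohomology, around one connecting map. -/
lemma lc_exact {f : M →ₗ[R] N} {g : N →ₗ[R] P} (hf : Function.Injective f)
    (hg : Function.Surjective g) (hfg : Function.Exact f g) :
    ∃ δ : lc J i P →ₗ[R] lc J (i + 1) M,
      Function.Exact (lcMap J i f) (lcMap J i g) ∧ Function.Exact (lcMap J i g) δ ∧
      Function.Exact δ (lcMap J (i + 1) f) := by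
  have hgf : ModuleCat.ofHom f ≫ ModuleCat.ofHom g = 0 := by
    rw [← ModuleCat.ofHom_comp, hfg.linearMap_comp_eq_zero]
    rfl
  have hS : (ShortComplex.mk _ _ hgf).ShortExact :=
    { exact := (ShortComplex.moduleCat_exact_iff _).2 fun b hb ↦ (hfg b).1 hb
      mono_f := (ModuleCat.mono_iff_injective _).2 hf
      epi_g := (ModuleCat.epi_iff_surjective _).2 hg }
  obtain ⟨δ, h₁, h₂, h₃⟩ := H.exists_exact J i hS
  exact ⟨δ, h₁, h₂, h₃⟩

variable (M) in
/-- The identification of `H⁰` with a submodule. -/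
def lcEv : lc J 0 M →ₗ[R] M := H.ev J (ModuleCat.of R M)

lemma lcEv_map (f : M →ₗ[R] N) (z : lc J 0 M) : lcEv J N (lcMap J 0 f z) = f (lcEv J M z) :=
  H.ev_map J (ModuleCat.ofHom f) z

lemma lcEv_injective : Function.Injective (lcEv J M) := H.ev_injective J (ModuleCat.of R M)

lemma exists_lcEv {t : ℕ} {a : M} (ha : ∀ r ∈ J ^ t, r • a = 0) : ∃ z, lcEv J M z = a :=
  H.exists_ev J (M := ModuleCat.of R M) t a ha

/-- Every element is killed by a power of `J`. -/
def IsTors (M : Type) [AddCommGroup M] [Module R M] : Prop :=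
  ∀ a : M, ∃ t, ∀ r ∈ J ^ t, r • a = 0

variable (M) in
/-- The submodule of elements killed by a power of `J`. -/
def gam : Submodule R M where
  carrier := {a | ∃ t, ∀ r ∈ J ^ t, r • a = 0}
  zero_mem' := ⟨0, by simp⟩
  add_mem' := by
    rintro a b ⟨s, hs⟩ ⟨t, ht⟩
    refine ⟨s + t, fun r hr ↦ ?_⟩
    rw [smul_add, hs r (Ideal.pow_le_pow_right (by omega) hr),
      ht r (Ideal.pow_le_pow_right (by omega) hr), add_zero]
  smul_mem' := by
    rintro c a ⟨s, hs⟩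
    exact ⟨s, fun r hr ↦ by rw [smul_comm, hs r hr, smul_zero]⟩

lemma isTors_gam : IsTors J (gam J M) := by
  rintro ⟨a, t, ht⟩
  exact ⟨t, fun r hr ↦ Subtype.ext (ht r hr)⟩

variable {J} in
lemma IsTors.of_surjective (h : IsTors J M) {f : M →ₗ[R] N} (hf : Function.Surjective f) :
    IsTors J N := by
  intro b
  obtain ⟨a, rfl⟩ := hf b
  obtain ⟨t, ht⟩ := h a
  exact ⟨t, fun r hr ↦ by rw [← map_smul, ht r hr, map_zero]⟩

variable {J} in
/-- A finitely generated torsion module is killed by one power of `J`. -/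
lemma IsTors.exists_pow [Module.Finite R M] (h : IsTors J M) :
    ∃ t, ∀ a : M, ∀ r ∈ J ^ t, r • a = 0 := by
  obtain ⟨s, hs⟩ := Module.Finite.fg_top (R := R) (M := M)
  choose t ht using h
  refine ⟨s.sup t, fun a r hr ↦ ?_⟩
  have ha : a ∈ Submodule.span R (s : Set M) := hs ▸ Submodule.mem_top
  induction ha using Submodule.span_induction with
  | mem x hx => exact ht x r (Ideal.pow_le_pow_right (Finset.le_sup hx) hr)
  | zero => rw [smul_zero]
  | add x y _ _ hx hy => rw [smul_add, hx, hy, add_zero]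
  | smul c x _ hx => rw [smul_comm, hx, smul_zero]

lemma gam_injective [IsNoetherianRing R] [hI : Module.Injective R M] :
    Module.Injective R (gam J M) := by
  apply Module.Baer.injective
  intro a g
  obtain ⟨t, ht⟩ : ∃ t, ∀ x, ∀ r ∈ J ^ t, r • g x = 0 := by
    have h : IsTors J (LinearMap.range g) := by
      rintro ⟨_, x, rfl⟩
      obtain ⟨t, ht⟩ := isTors_gam J (g x)
      exact ⟨t, fun r hr ↦ Subtype.ext (ht r hr)⟩
    obtain ⟨t, ht⟩ := h.exists_pow
    exact ⟨t, fun x r hr ↦ congrArg Subtype.val (ht ⟨g x, x, rfl⟩ r hr)⟩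
  obtain ⟨k, hk⟩ := Ideal.exists_pow_inf_eq_pow_smul J (M := R) a
  let ι : a →ₗ[R] R ⧸ J ^ (t + k) := (J ^ (t + k)).mkQ ∘ₗ a.subtype
  have hι : LinearMap.ker ι ≤ LinearMap.ker ((gam J M).subtype ∘ₗ g) := by
    intro x hx
    have hx' : (x : R) ∈ J ^ (t + k) := by
      exact (Submodule.Quotient.mk_eq_zero _).1 hx
    have h1 : (x : R) ∈ J ^ t • a := by
      have : (x : R) ∈ J ^ (t + k) • (⊤ : Submodule R R) ⊓ a := ⟨by simpa using hx', x.2⟩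
      rw [hk _ (by omega), Nat.add_sub_cancel] at this
      exact Submodule.smul_mono le_rfl inf_le_right this
    have h2 : ∀ y (hy : y ∈ J ^ t • a) (hya : y ∈ a), g ⟨y, hya⟩ = 0 := by
      intro y hy
      induction hy using Submodule.smul_induction_on' with
      | smul r hr n hn =>
        intro hya
        have := ht ⟨n, hn⟩ r hr
        rw [← map_smul] at this
        exact this
      | add y hy z hz h h' =>
        intro hya
        have hy' : y ∈ a := Submodule.smul_le_right hy
        have hz' : z ∈ a := Submodule.smul_le_right hz
        have : (⟨y + z, hya⟩ : a) = ⟨y, hy'⟩ + ⟨z, hz'⟩ := rfl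
        rw [this, map_add, h, h', add_zero]
    exact congrArg Subtype.val (h2 x h1 x.2)
  obtain ⟨F, hF⟩ := hI.out ((LinearMap.ker ι).liftQ ι le_rfl)
    (LinearMap.ker_eq_bot.1 (Submodule.ker_liftQ_eq_bot _ _ _ le_rfl))
    ((LinearMap.ker ι).liftQ _ hι)
  refine ⟨(F ∘ₗ (J ^ (t + k)).mkQ).codRestrict (gam J M) fun r ↦ ⟨t + k, fun s hs ↦ ?_⟩,
    fun x hx ↦ Subtype.ext ?_⟩
  · rw [← map_smul, LinearMap.comp_apply]
    have : (J ^ (t + k)).mkQ (s • r) = 0 := by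
      rw [Submodule.mkQ_apply, Submodule.Quotient.mk_eq_zero]
      exact Ideal.mul_mem_right _ _ hs
    rw [this, map_zero]
  · exact hF (Submodule.Quotient.mk ⟨x, hx⟩)

lemma exists_injective_embedding (M : Type) [AddCommGroup M] [Module R M] :
    ∃ (I : Type) (_ : AddCommGroup I) (_ : Module R I) (_ : Module.Injective R I)
      (f : M →ₗ[R] I), Function.Injective f := by
  exact ⟨(Injective.under (ModuleCat.of R M) : ModuleCat.{0} R), inferInstance, inferInstance,
    Module.injective_module_of_injective_object R _ (inj := inferInstanceAs
      (Injective (Injective.under (ModuleCat.of R M)))), (Injective.ι (ModuleCat.of R M)).hom,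
    (ModuleCat.mono_iff_injective (Injective.ι (ModuleCat.of R M))).1 inferInstance⟩

/-- Torsion modules have no higher local cohomology. -/
lemma IsTors.lc_eq_zero [IsNoetherianRing R] (i : ℕ) :
    ∀ {M : Type} [AddCommGroup M] [Module R M], IsTors J M → ∀ z : lc J (i + 1) M, z = 0 := by
  induction i with
  | zero =>
    intro M _ _ hM z
    obtain ⟨I, _, _, _, f, hf⟩ := exists_injective_embedding (R := R) M
    let f' : M →ₗ[R] gam J I := f.codRestrict _ fun a ↦ by
      obtain ⟨t, ht⟩ := hM a
      exact ⟨t, fun r hr ↦ by rw [← map_smul, ht r hr, map_zero]⟩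
    have hf' : Function.Injective f' := fun a b h ↦ hf (congrArg Subtype.val h)
    have := gam_injective J (M := I)
    obtain ⟨δ, h₂, h₃, h₁⟩ := lc_exact J 0 hf' (Submodule.mkQ_surjective (LinearMap.range f'))
      (LinearMap.exact_map_mkQ_range f')
    obtain ⟨y, rfl⟩ := (h₁ z).1 (lc_eq_zero_of_injective J 0 _)
    refine (h₃ y).2 ?_
    obtain ⟨c, hc⟩ := Submodule.mkQ_surjective (LinearMap.range f') (lcEv J _ y)
    obtain ⟨t, ht⟩ := isTors_gam J c
    obtain ⟨w, hw⟩ := exists_lcEv J ht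
    refine ⟨w, lcEv_injective J ?_⟩
    rw [lcEv_map, hw, hc]
  | succ i ih =>
    intro M _ _ hM z
    obtain ⟨I, _, _, _, f, hf⟩ := exists_injective_embedding (R := R) M
    let f' : M →ₗ[R] gam J I := f.codRestrict _ fun a ↦ by
      obtain ⟨t, ht⟩ := hM a
      exact ⟨t, fun r hr ↦ by rw [← map_smul, ht r hr, map_zero]⟩
    have hf' : Function.Injective f' := fun a b h ↦ hf (congrArg Subtype.val h)
    have := gam_injective J (M := I)
    obtain ⟨δ, h₂, h₃, h₁⟩ := lc_exact J (i + 1) hf'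
      (Submodule.mkQ_surjective (LinearMap.range f')) (LinearMap.exact_map_mkQ_range f')
    obtain ⟨y, rfl⟩ := (h₁ z).1 (lc_eq_zero_of_injective J (i + 1) _)
    rw [ih ((isTors_gam J).of_surjective (Submodule.mkQ_surjective _)) y, map_zero]
end
end LocalCoh

namespace LocalCoh

section Dim

lemma lt_natCast_of_add_one_lt {s : WithBot ℕ∞} {i : ℕ}
    (h : s + 1 < ((i + 1 : ℕ) : WithBot ℕ∞)) : s < (i : WithBot ℕ∞) := by
  by_contra! h'
  have : ((i + 1 : ℕ) : WithBot ℕ∞) ≤ s + 1 := by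
    push_cast
    gcongr
  exact absurd h this.not_gt

lemma eq_natCast_of_add_one_eq {s : WithBot ℕ∞} {i : ℕ}
    (h : s + 1 = ((i + 1 : ℕ) : WithBot ℕ∞)) : s = (i : WithBot ℕ∞) := by
  induction s using WithBot.recBotCoe with
  | bot => exact absurd h WithBot.bot_ne_coe
  | coe s =>
    have h' : s + 1 = (i : ℕ∞) + 1 := by exact_mod_cast h
    rw [ENat.add_left_injective_of_ne_top ENat.one_ne_top h']
    rfl

variable {R : Type} [CommRing R]

/-- A finite set of primes can be avoided by an element outside of all of them. -/
lemma exists_mem_forall_notMem {I : Ideal R} {s : Set (Ideal R)} (hs : s.Finite)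
    (hp : ∀ p ∈ s, p.IsPrime) (hI : ∀ p ∈ s, ¬ I ≤ p) : ∃ x ∈ I, ∀ p ∈ s, x ∉ p := by
  by_contra! h
  obtain ⟨p, hps, hIp⟩ := (Ideal.subset_union_prime_finite hs (f := id) 0 0
    (fun p h _ _ ↦ hp p h)).1 (show (I : Set R) ⊆ ⋃ p ∈ s, ((id p : Ideal R) : Set R) from
      fun x hx ↦ by
        obtain ⟨p, hps, hxp⟩ := h x hx
        exact Set.mem_biUnion hps hxp)
  exact hI p hps hIp

variable {M : Type} [AddCommGroup M] [Module R M]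

lemma ringKrullDim_quotient_le_supportDim {p : PrimeSpectrum R} (hp : p ∈ Module.support R M) :
    ringKrullDim (R ⧸ p.asIdeal) ≤ Module.supportDim R M := by
  rw [ringKrullDim_quotient]
  have h : PrimeSpectrum.zeroLocus (p.asIdeal : Set R) ⊆ Module.support R M := fun q hq ↦
    Module.mem_support_mono (show p ≤ q from hq) hp
  exact Order.krullDim_le_of_strictMono (Set.inclusion h) fun a b hab ↦ hab

lemma ringKrullDim_quotient_add_one_le {p q : PrimeSpectrum R} (h : p < q) :
    ringKrullDim (R ⧸ q.asIdeal) + 1 ≤ ringKrullDim (R ⧸ p.asIdeal) := by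
  obtain ⟨hle, hlt⟩ := (lt_iff_le_not_ge.1 h : p.asIdeal ≤ q.asIdeal ∧ ¬ q.asIdeal ≤ p.asIdeal)
  obtain ⟨r, hrq, hrp⟩ := SetLike.not_le_iff_exists.1 hlt
  refine ringKrullDim_succ_le_of_surjective (Ideal.Quotient.factor hle)
    (Ideal.Quotient.factor_surjective hle) (r := Ideal.Quotient.mk _ r) ?_ ?_
  · rw [mem_nonZeroDivisors_iff_ne_zero]
    exact fun h ↦ hrp (Ideal.Quotient.eq_zero_iff_mem.1 h)
  · rw [Ideal.Quotient.factor_mk]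
    exact Ideal.Quotient.eq_zero_iff_mem.2 hrq

/-- A prime in the support of maximal dimension is minimal in the support. -/
lemma eq_of_le_of_ringKrullDim_eq {p q : PrimeSpectrum R} (hp : p ∈ Module.support R M) {d : ℕ}
    (hM : Module.supportDim R M = d) (hpq : p ≤ q)
    (hq : ringKrullDim (R ⧸ q.asIdeal) = d) : p = q := by
  by_contra hne
  have h1 := ringKrullDim_quotient_add_one_le (lt_of_le_of_ne hpq hne)
  have h2 := h1.trans (ringKrullDim_quotient_le_supportDim hp)
  rw [hq, hM] at h2
  have : d + 1 ≤ d := by exact_mod_cast h2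
  omega

/-- There are primes of maximal dimension. -/
lemma exists_mem_support_ringKrullDim_eq {d : ℕ} (hM : Module.supportDim R M = d) :
    ∃ p ∈ Module.support R M, ringKrullDim (R ⧸ p.asIdeal) = d := by
  obtain ⟨l, hl⟩ := Order.le_krullDim_iff.1 hM.ge
  refine ⟨l.head, l.head.2, le_antisymm (hM ▸ ringKrullDim_quotient_le_supportDim l.head.2) ?_⟩
  rw [ringKrullDim_quotient]
  refine Order.le_krullDim_iff.2 ⟨⟨l.length, fun i ↦ ⟨l i, l.head_le i⟩, fun i ↦ l.step i⟩, hl⟩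

variable [Module.Finite R M]

lemma mem_minimalPrimes_of_ringKrullDim_eq {q : PrimeSpectrum R} (hq : q ∈ Module.support R M)
    {d : ℕ} (hM : Module.supportDim R M = d) (hqd : ringKrullDim (R ⧸ q.asIdeal) = d) :
    q.asIdeal ∈ (Module.annihilator R M).minimalPrimes := by
  refine ⟨⟨q.2, Module.mem_support_iff_of_finite.1 hq⟩, fun p hp hpq ↦ ?_⟩
  have := eq_of_le_of_ringKrullDim_eq (p := ⟨p, hp.1⟩)
    (Module.mem_support_iff_of_finite.2 hp.2) hM hpq hqd
  exact (congrArg PrimeSpectrum.asIdeal this).ge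

/-- Dividing by an element outside the primes of maximal dimension lowers the dimension. -/
lemma supportDim_quotSMulTop_lt {d : ℕ} (hM : Module.supportDim R M = d) {x : R}
    (hx : ∀ p ∈ Module.support R M, ringKrullDim (R ⧸ p.asIdeal) = d → x ∉ p.asIdeal) :
    Module.supportDim R (QuotSMulTop x M) < d := by
  have hle : Module.supportDim R (QuotSMulTop x M) ≤ d :=
    hM ▸ Module.supportDim_le_of_surjective _ (Submodule.mkQ_surjective _)
  refine lt_of_le_of_ne hle fun h ↦ ?_
  obtain ⟨p, hp, hpd⟩ := exists_mem_support_ringKrullDim_eq h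
  rw [Module.support_quotSMulTop] at hp
  exact hx p hp.1 hpd (hp.2 rfl)

end Dim

section Local

section

variable {R : Type} [CommRing R] [IsLocalRing R]

lemma isArtinian_of_pow_smul_eq_zero (t : ℕ) :
    ∀ (N : Type) [AddCommGroup N] [Module R N] [IsNoetherian R N],
      (∀ a : N, ∀ r ∈ maximalIdeal R ^ t, r • a = 0) → IsArtinian R N := by
  induction t with
  | zero =>
    intro N _ _ _ h
    have : Subsingleton N := ⟨fun a b ↦ by
      rw [← one_smul R a, ← one_smul R b, h a 1 (by simp), h b 1 (by simp)]⟩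
    infer_instance
  | succ t ih =>
    intro N _ _ _ h
    rw [isArtinian_iff_submodule_quotient (maximalIdeal R • (⊤ : Submodule R N))]
    constructor
    · refine ih _ fun a r hr ↦ Subtype.ext ?_
      obtain ⟨a, ha⟩ := a
      change r • a = 0
      induction ha using Submodule.smul_induction_on' with
      | smul s hs n hn =>
        rw [smul_smul]
        exact h n _ (pow_succ (maximalIdeal R) t ▸ Ideal.mul_mem_mul hr hs)
      | add y hy z hz h h' => rw [smul_add, h, h', add_zero]
    · have : Module.Finite (R ⧸ maximalIdeal R) (N ⧸ maximalIdeal R • (⊤ : Submodule R N)) :=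
        Module.Finite.of_restrictScalars_finite R _ _
      let : Field (R ⧸ maximalIdeal R) := Ideal.Quotient.field _
      exact isArtinian_of_surjective_algebraMap (R := R ⧸ maximalIdeal R)
        Ideal.Quotient.mk_surjective

end

variable {R : Type} [CommRing R] [IsNoetherianRing R] [IsLocalRing R]
variable {M : Type} [AddCommGroup M] [Module R M] [Module.Finite R M]

lemma IsTors.isArtinian (h : IsTors (maximalIdeal R) M) : IsArtinian R M := by
  obtain ⟨t, ht⟩ := h.exists_pow
  exact isArtinian_of_pow_smul_eq_zero t M ht

/-- A nonzero finitely generated module without torsion has a regular element. -/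
lemma exists_isSMulRegular (h : ∀ a : M, (∀ r ∈ maximalIdeal R, r • a = 0) → a = 0) :
    ∃ x ∈ maximalIdeal R, IsSMulRegular M x := by
  obtain ⟨x, hx, hxp⟩ := exists_mem_forall_notMem (I := maximalIdeal R)
    (associatedPrimes.finite R M) (fun p hp ↦ hp.1) fun p hp hle ↦ by
      obtain ⟨hp1, a, rfl⟩ := isAssociatedPrime_iff.1 hp
      have ha : a = 0 := h a fun r hr ↦ by simpa [Submodule.mem_colon_singleton] using hle hr
      exact hp1.ne_top (by simp [ha])
  refine ⟨x, hx, ?_⟩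
  by_contra hreg
  have : x ∈ ⋃ p ∈ associatedPrimes R M, (p : Set R) := by
    rw [biUnion_associatedPrimes_eq_compl_regular]
    exact hreg
  obtain ⟨p, hp, hxp'⟩ := Set.mem_iUnion₂.1 this
  exact hxp p hp hxp'

/-- Killing torsion leaves no torsion. -/
lemma quotient_gam_eq_zero {a : M ⧸ gam (maximalIdeal R) M}
    (ha : ∀ r ∈ maximalIdeal R, r • a = 0) : a = 0 := by
  obtain ⟨b, rfl⟩ := Submodule.mkQ_surjective _ a
  obtain ⟨t, ht⟩ := (isTors_gam (maximalIdeal R) (M := M)).exists_pow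
  rw [Submodule.mkQ_apply, Submodule.Quotient.mk_eq_zero]
  refine ⟨t + 1, fun r hr ↦ ?_⟩
  rw [pow_succ] at hr
  induction hr using Submodule.mul_induction_on' with
  | mem_mul_mem s hs u hu =>
    have : u • b ∈ gam (maximalIdeal R) M := by
      rw [← Submodule.Quotient.mk_eq_zero]
      exact ha u hu
    rw [mul_smul]
    exact congrArg Subtype.val (ht ⟨_, this⟩ s hs)
  | add y hy z hz h h' => rw [add_smul, h, h', add_zero]

lemma exists_isSMulRegular_quotient_gam :
    ∃ x ∈ maximalIdeal R, IsSMulRegular (M ⧸ gam (maximalIdeal R) M) x :=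
  exists_isSMulRegular fun _ ↦ quotient_gam_eq_zero

end Local
end LocalCoh

namespace LocalCoh

section Artinian

variable {R : Type} [CommRing R] {A : Type} [AddCommGroup A] [Module R A]

/-- Melkersson's criterion: an `x`-torsion module is Artinian if the kernel of `x` is. -/
lemma isArtinian_of_ker_lsmul (x : R) (hx : ∀ a : A, ∃ n, x ^ n • a = 0)
    [hA : IsArtinian R (LinearMap.ker (LinearMap.lsmul R A x))] : IsArtinian R A := by
  let K := LinearMap.ker (LinearMap.lsmul R A x)
  let L (N : Submodule R A) (n : ℕ) : Submodule R K :=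
    (N.map (LinearMap.lsmul R A (x ^ n))).comap K.subtype
  have hL₁ {N N' : Submodule R A} (h : N ≤ N') (n : ℕ) : L N n ≤ L N' n :=
    Submodule.comap_mono (Submodule.map_mono h)
  have hL₂ (N : Submodule R A) : Antitone (L N) := by
    refine antitone_nat_of_succ_le fun n ↦ Submodule.comap_mono ?_
    rintro _ ⟨a, ha, rfl⟩
    exact ⟨x • a, N.smul_mem x ha, by simp [pow_succ, mul_smul, smul_comm x]⟩
  rw [← monotone_stabilizes_iff_artinian]
  intro f
  let g (k : ℕ) : Submodule R A := OrderDual.ofDual (f k)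
  have hf {k l : ℕ} (h : k ≤ l) : g l ≤ g k := f.monotone h
  obtain ⟨k₀, hk₀⟩ : ∃ n, ∀ m, n ≤ m → L (g n) n = L (g m) m :=
    IsArtinian.monotone_stabilizes (R := R) (M := K) ⟨fun k ↦ OrderDual.toDual (L (g k) k),
      fun k l h ↦ OrderDual.toDual_le_toDual.2 ((hL₁ (hf h) l).trans (hL₂ (g k) h))⟩
  have hst (n : ℕ) : ∃ k, ∀ l, k ≤ l → L (g k) n = L (g l) n :=
    IsArtinian.monotone_stabilizes (R := R) (M := K) ⟨fun k ↦ OrderDual.toDual (L (g k) n),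
      fun k l h ↦ OrderDual.toDual_le_toDual.2 (hL₁ (hf h) n)⟩
  choose c hc using hst
  let e := max k₀ ((Finset.range k₀).sup c)
  have key (n l : ℕ) (hl : e ≤ l) : L (g e) n ≤ L (g l) n := by
    rcases lt_or_ge n k₀ with hn | hn
    · have hce : c n ≤ e := (Finset.le_sup (Finset.mem_range.2 hn)).trans (le_max_right _ _)
      exact ((hc n e hce).symm.trans (hc n l (hce.trans hl))).le
    · have h₁ : L (g e) n ≤ L (g k₀) k₀ := (hL₁ (hf (le_max_left _ _)) n).trans (hL₂ _ hn)
      have h₂ : L (g (max n l)) (max n l) ≤ L (g l) n :=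
        (hL₁ (hf (le_max_right n l)) _).trans (hL₂ _ (le_max_left n l))
      exact h₁.trans ((hk₀ (max n l) (hn.trans (le_max_left n l))).le.trans h₂)
  refine ⟨e, fun l hl ↦ le_antisymm (α := Submodule R A) ?_ (hf hl)⟩
  have main (n : ℕ) : ∀ a ∈ g e, x ^ n • a = 0 → a ∈ g l := by
    induction n with
    | zero =>
      intro a _ h
      rw [pow_zero, one_smul] at h
      exact h ▸ Submodule.zero_mem _
    | succ n ih =>
      intro a ha h
      have hK : x ^ n • a ∈ K := by
        rw [LinearMap.mem_ker, LinearMap.lsmul_apply, smul_smul, ← pow_succ', h]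
      obtain ⟨b, hb, hba⟩ := key n l hl (show (⟨x ^ n • a, hK⟩ : K) ∈ L (g e) n from ⟨a, ha, rfl⟩)
      have hab := ih (a - b) (Submodule.sub_mem _ ha (hf hl hb))
        (by rw [smul_sub, sub_eq_zero]; exact hba.symm)
      simpa using Submodule.add_mem _ hab hb
  intro a ha
  obtain ⟨n, hn⟩ := hx a
  exact main n a ha hn

/-- A sup-irreducible Artinian submodule is divisible or killed by powers of a given element. -/
lemma smul_eq_or_pow_smul_eq_zero [IsArtinian R A] {B : Submodule R A} (hB : SupIrred B) (r : R) :
    B ≤ B.map (LinearMap.lsmul R A r) ∨ ∃ n, ∀ b ∈ B, r ^ n • b = 0 := by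
  have hanti : Antitone fun n ↦ B.map (LinearMap.lsmul R A (r ^ n)) := by
    refine antitone_nat_of_succ_le fun n ↦ ?_
    rintro _ ⟨a, ha, rfl⟩
    exact ⟨r • a, B.smul_mem r ha, by simp [pow_succ, mul_smul, smul_comm r]⟩
  obtain ⟨n, hn⟩ : ∃ n, ∀ m, n ≤ m → B.map (LinearMap.lsmul R A (r ^ n)) =
      B.map (LinearMap.lsmul R A (r ^ m)) :=
    IsArtinian.monotone_stabilizes (R := R) (M := A)
      ⟨fun n ↦ OrderDual.toDual (B.map (LinearMap.lsmul R A (r ^ n))),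
        fun k l h ↦ OrderDual.toDual_le_toDual.2 (hanti h)⟩
  have hsup : B.map (LinearMap.lsmul R A (r ^ (n + 1))) ⊔
      (LinearMap.ker (LinearMap.lsmul R A (r ^ (n + 1))) ⊓ B) = B := by
    refine le_antisymm (sup_le ?_ inf_le_right) fun b hb ↦ ?_
    · rintro _ ⟨a, ha, rfl⟩
      exact B.smul_mem _ ha
    · have h1 : r ^ (n + 1) • b ∈ B.map (LinearMap.lsmul R A (r ^ (n + 1 + (n + 1)))) := by
        have := (hn (n + 1) (by omega)).symm.trans (hn (n + 1 + (n + 1)) (by omega))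
        exact this.le ⟨b, hb, rfl⟩
      obtain ⟨c, hc, hcb⟩ := h1
      refine Submodule.mem_sup.2 ⟨r ^ (n + 1) • c, ⟨c, hc, rfl⟩, b - r ^ (n + 1) • c,
        ⟨?_, B.sub_mem hb (B.smul_mem _ hc)⟩, by simp⟩
      rw [SetLike.mem_coe, LinearMap.mem_ker, LinearMap.lsmul_apply, smul_sub, sub_eq_zero, smul_smul,
        ← pow_add]
      exact hcb.symm
  rcases hB.2 hsup with h | h
  · left
    calc B ≤ _ := h.ge
      _ ≤ _ := hanti (show 1 ≤ n + 1 by omega)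
      _ = _ := by simp
  · right
    exact ⟨n + 1, fun b hb ↦ (h.ge hb).1⟩

/-- The radical of the annihilator of a sup-irreducible submodule is prime. -/
lemma isPrime_radical_annihilator [IsArtinian R A] {B : Submodule R A} (hB : SupIrred B) :
    B.annihilator.radical.IsPrime := by
  have hmem (r : R) : r ∈ B.annihilator.radical ↔ ∃ n, ∀ b ∈ B, r ^ n • b = 0 := by
    simp only [Ideal.mem_radical_iff, Submodule.mem_annihilator]
  have hbot : ∃ b ∈ B, b ≠ 0 := B.ne_bot_iff.1 hB.ne_bot
  refine ⟨fun h ↦ ?_, fun {r s} hrs ↦ ?_⟩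
  · obtain ⟨b, hb, hb0⟩ := hbot
    obtain ⟨n, hn⟩ := (hmem 1).1 (h ▸ Submodule.mem_top)
    exact hb0 (by simpa using hn b hb)
  · by_contra! h
    have hr := (smul_eq_or_pow_smul_eq_zero hB r).resolve_right fun h' ↦ h.1 ((hmem r).2 h')
    have hs := (smul_eq_or_pow_smul_eq_zero hB s).resolve_right fun h' ↦ h.2 ((hmem s).2 h')
    have key (n : ℕ) : ∀ b ∈ B, ∃ c ∈ B, (r * s) ^ n • c = b := by
      induction n with
      | zero => exact fun b hb ↦ ⟨b, hb, by simp⟩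
      | succ n ih =>
        intro b hb
        obtain ⟨c, hc, rfl⟩ := ih b hb
        obtain ⟨c, hc', rfl⟩ := hr hc
        obtain ⟨c, hc'', rfl⟩ := hs hc'
        exact ⟨c, hc'', by simp only [pow_succ, mul_smul, LinearMap.lsmul_apply]⟩
    obtain ⟨n, hn⟩ := (hmem (r * s)).1 hrs
    obtain ⟨b, hb, hb0⟩ := hbot
    obtain ⟨c, hc, rfl⟩ := key n b hb
    exact hb0 (hn c hc)

/-- A general element has cokernel killed by a power of the maximal ideal on an Artinian module. -/
lemma exists_pow_smul_mem_range [IsNoetherianRing R] [IsLocalRing R] [IsArtinian R A]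
    {S : Set (Ideal R)} (hS : S.Finite) (hp : ∀ p ∈ S, p.IsPrime)
    (hm : ∀ p ∈ S, p ≠ maximalIdeal R) :
    ∃ x ∈ maximalIdeal R, (∀ p ∈ S, x ∉ p) ∧
      ∃ n, ∀ a : A, ∀ r ∈ maximalIdeal R ^ n, ∃ b, x • b = r • a := by
  obtain ⟨s, hs, hirr⟩ := exists_supIrred_decomposition (⊤ : Submodule R A)
  let T : Set (Ideal R) := {p ∈ (fun B : Submodule R A ↦ B.annihilator.radical) '' s |
    p ≠ maximalIdeal R}
  have hT : T.Finite := (s.finite_toSet.image _).subset (Set.sep_subset _ _)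
  have hpT : ∀ p ∈ S ∪ T, p.IsPrime ∧ p ≠ maximalIdeal R := by
    rintro p (h | ⟨⟨B, hB, rfl⟩, h⟩)
    · exact ⟨hp p h, hm p h⟩
    · exact ⟨isPrime_radical_annihilator (hirr hB), h⟩
  obtain ⟨x, hx, hxS⟩ := exists_mem_forall_notMem (I := maximalIdeal R) (hS.union hT)
    (fun p h ↦ (hpT p h).1) fun p h hle ↦
      (hpT p h).2 (((le_maximalIdeal (hpT p h).1.ne_top).antisymm hle))
  refine ⟨x, hx, fun p h ↦ hxS p (Or.inl h), ?_⟩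
  let Q (n : ℕ) : Submodule R A := ⨅ r ∈ maximalIdeal R ^ n,
    (LinearMap.range (LinearMap.lsmul R A x)).comap (LinearMap.lsmul R A r)
  have hQ {n : ℕ} {a : A} : a ∈ Q n ↔ ∀ r ∈ maximalIdeal R ^ n, ∃ b, x • b = r • a := by
    simp [Q, Submodule.mem_iInf]
  have hB (B : Submodule R A) (h : B ∈ s) : ∃ n, B ≤ Q n := by
    rcases smul_eq_or_pow_smul_eq_zero (hirr h) x with h' | h'
    · refine ⟨0, fun b hb ↦ hQ.2 fun r _ ↦ ?_⟩
      obtain ⟨c, -, rfl⟩ := h' hb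
      exact ⟨r • c, smul_comm _ _ _⟩
    · have hrad : B.annihilator.radical = maximalIdeal R := by
        by_contra hne
        refine hxS _ (Or.inr ⟨⟨B, h, rfl⟩, hne⟩) ?_
        simpa only [Ideal.mem_radical_iff, Submodule.mem_annihilator] using h'
      obtain ⟨n, hn⟩ := Ideal.exists_pow_le_of_le_radical_of_fg hrad.ge
        (Ideal.fg_of_isNoetherianRing _)
      exact ⟨n, fun b hb ↦ hQ.2 fun r hr ↦
        ⟨0, by rw [smul_zero, Submodule.mem_annihilator.1 (hn hr) b hb]⟩⟩
  choose! c hc using hB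
  refine ⟨s.sup c, fun a ↦ hQ.1 ?_⟩
  have hle : s.sup id ≤ Q (s.sup c) := Finset.sup_le fun B h b hb ↦
    hQ.2 fun r hr ↦ hQ.1 (hc B h hb) r (Ideal.pow_le_pow_right (Finset.le_sup h) hr)
  exact hle (hs ▸ Submodule.mem_top)

end Artinian

section Local

variable {R : Type} [CommRing R]
variable {M N P : Type} [AddCommGroup M] [Module R M] [AddCommGroup N] [Module R N]

/-- The long exact sequence of a regular element. -/
lemma lc_exact_smul {x : R} (hx : IsSMulRegular M x) (J : Ideal R) (i : ℕ) :
    ∃ δ : lc J i (QuotSMulTop x M) →ₗ[R] lc J (i + 1) M,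
      (∀ z, lcMap J i (x • (⊤ : Submodule R M)).mkQ z = 0 → ∃ y, x • y = z) ∧
      Function.Exact (lcMap J i (x • (⊤ : Submodule R M)).mkQ) δ ∧
      ∀ z : lc J (i + 1) M, x • z = 0 ↔ ∃ y, δ y = z := by
  obtain ⟨δ, h₁, h₂, h₃⟩ := lc_exact J i (f := LinearMap.lsmul R M x) hx
    (Submodule.mkQ_surjective (x • (⊤ : Submodule R M))) fun b ↦ by
      rw [Submodule.mkQ_apply, Submodule.Quotient.mk_eq_zero]
      simp [Submodule.mem_smul_pointwise_iff_exists]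
  refine ⟨δ, fun z hz ↦ ?_, h₂, fun z ↦ ?_⟩
  · obtain ⟨y, rfl⟩ := (h₁ z).1 hz
    exact ⟨y, (lcMap_lsmul J i x y).symm⟩
  · rw [← lcMap_lsmul]
    exact h₃ z

/-- Elements of `J` act nilpotently on each element of local cohomology. -/
lemma exists_pow_smul_eq_zero {J : Ideal R} {i : ℕ} {x : R} (hx : x ∈ J) (z : lc J i M) :
    ∃ n, x ^ n • z = 0 := by
  obtain ⟨t, ht⟩ := lc_torsion J i z
  exact ⟨t, ht _ (Ideal.pow_mem_pow hx t)⟩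

lemma eq_zero_of_pow_smul {A : Type} [AddCommGroup A] [Module R A] {x : R}
    (hx : ∀ z : A, x • z = 0 → z = 0) (n : ℕ) : ∀ z : A, x ^ n • z = 0 → z = 0 := by
  induction n with
  | zero => simp
  | succ n ih =>
    intro z hz
    rw [pow_succ, mul_smul] at hz
    exact hx z (ih _ hz)

variable [IsNoetherianRing R]

/-- Killing torsion is injective on higher local cohomology. -/
lemma lcMap_mkQ_gam_injective (J : Ideal R) (i : ℕ) :
    Function.Injective (lcMap J (i + 1) (gam J M).mkQ) := by
  obtain ⟨δ, h₁, h₂, h₃⟩ := lc_exact J (i + 1) (gam J M).injective_subtype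
    (gam J M).mkQ_surjective (LinearMap.exact_subtype_mkQ _)
  rw [injective_iff_map_eq_zero]
  intro z hz
  obtain ⟨y, rfl⟩ := (h₁ z).1 hz
  rw [(isTors_gam J).lc_eq_zero J i y, map_zero]

variable [IsLocalRing R]

/-- Local cohomology vanishes above the dimension. -/
theorem lc_eq_zero_of_supportDim_lt (i : ℕ) :
    ∀ {M : Type} [AddCommGroup M] [Module R M] [Module.Finite R M],
      Module.supportDim R M < i → ∀ z : lc (maximalIdeal R) i M, z = 0 := by
  induction i with
  | zero =>
    intro M _ _ _ h z
    have : Subsingleton M := by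
      rw [← Module.supportDim_eq_bot_iff_subsingleton R]
      by_contra h'
      obtain ⟨a, ha⟩ := WithBot.ne_bot_iff_exists.1 h'
      rw [← ha] at h
      exact absurd (show a < 0 by exact_mod_cast h) not_lt_zero
    exact lc_eq_zero_of_subsingleton _ _ z
  | succ i ih =>
    intro M _ _ _ h z
    apply lcMap_mkQ_gam_injective (maximalIdeal R) i
    rw [map_zero]
    obtain ⟨x, hx, hreg⟩ := exists_isSMulRegular_quotient_gam (R := R) (M := M)
    have hdim := Module.supportDim_quotSMulTop_succ_eq_supportDim hreg hx
    have h' : Module.supportDim R (M ⧸ gam (maximalIdeal R) M) < (i + 1 : ℕ) :=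
      (Module.supportDim_le_of_surjective _ (Submodule.mkQ_surjective _)).trans_lt h
    rw [← hdim] at h'
    obtain ⟨δ, -, -, h₃⟩ := lc_exact_smul hreg (maximalIdeal R) i
    obtain ⟨n, hn⟩ := exists_pow_smul_eq_zero hx
      (lcMap (maximalIdeal R) (i + 1) (gam (maximalIdeal R) M).mkQ z)
    refine eq_zero_of_pow_smul (fun w hw ↦ ?_) n _ hn
    obtain ⟨y, rfl⟩ := (h₃ w).1 hw
    rw [ih (lt_natCast_of_add_one_lt h') y, map_zero]

/-- Local cohomology of a finitely generated module is Artinian. -/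
theorem isArtinian_lc (i : ℕ) :
    ∀ (M : Type) [AddCommGroup M] [Module R M] [Module.Finite R M],
      IsArtinian R (lc (maximalIdeal R) i M) := by
  induction i with
  | zero =>
    intro M _ _ _
    have h : IsTors (maximalIdeal R) (LinearMap.range (lcEv (maximalIdeal R) M)) := by
      rintro ⟨_, z, rfl⟩
      obtain ⟨t, ht⟩ := lc_torsion (maximalIdeal R) 0 z
      exact ⟨t, fun r hr ↦ Subtype.ext (by
        rw [Submodule.coe_smul, ← map_smul, ht r hr, map_zero]; rfl)⟩
    have := h.isArtinian
    exact isArtinian_of_injective (lcEv (maximalIdeal R) M).rangeRestrict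
      ((Set.rangeFactorization_injective).2 (lcEv_injective _))
  | succ i ih =>
    intro M _ _ _
    obtain ⟨x, hx, hreg⟩ := exists_isSMulRegular_quotient_gam (R := R) (M := M)
    obtain ⟨δ, -, -, h₃⟩ := lc_exact_smul hreg (maximalIdeal R) i
    have := ih (QuotSMulTop x (M ⧸ gam (maximalIdeal R) M))
    have hker : LinearMap.range δ =
        LinearMap.ker (LinearMap.lsmul R
          (lc (maximalIdeal R) (i + 1) (M ⧸ gam (maximalIdeal R) M)) x) :=
      Submodule.ext fun z ↦ (h₃ z).symm
    have : IsArtinian R (LinearMap.range δ) :=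
      isArtinian_of_surjective _ δ.rangeRestrict δ.surjective_rangeRestrict
    rw [hker] at this
    have := isArtinian_of_ker_lsmul
      (A := lc (maximalIdeal R) (i + 1) (M ⧸ gam (maximalIdeal R) M)) x
      (exists_pow_smul_eq_zero hx)
    exact isArtinian_of_injective _ (lcMap_mkQ_gam_injective (maximalIdeal R) i)

/-- Surjections induce surjections on top local cohomology. -/
theorem lcMap_surjective [AddCommGroup P] [Module R P] [Module.Finite R M] {d : ℕ}
    (hM : Module.supportDim R M ≤ d) {f : M →ₗ[R] P} (hf : Function.Surjective f) :
    Function.Surjective (lcMap (maximalIdeal R) d f) := by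
  obtain ⟨δ, -, h₂, -⟩ := lc_exact (maximalIdeal R) d (LinearMap.ker f).injective_subtype hf
    (LinearMap.exact_subtype_ker_map f)
  intro z
  refine (h₂ z).1 (lc_eq_zero_of_supportDim_lt (d + 1) (lt_of_le_of_lt
    ((Module.supportDim_le_of_injective _ (LinearMap.ker f).injective_subtype).trans hM) ?_) _)
  exact_mod_cast Nat.lt_succ_self d

/-- Elements outside the primes of maximal dimension act surjectively on top local cohomology. -/
theorem exists_smul_eq [Module.Finite R M] {d : ℕ} (hM : Module.supportDim R M = d) {x : R}
    (hx : ∀ p ∈ Module.support R M, ringKrullDim (R ⧸ p.asIdeal) = d → x ∉ p.asIdeal)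
    (z : lc (maximalIdeal R) d M) : ∃ y, x • y = z := by
  let g := (LinearMap.lsmul R M x).rangeRestrict
  let N := LinearMap.range (LinearMap.lsmul R M x)
  have hN : N = x • (⊤ : Submodule R M) := Submodule.ext fun b ↦ by
    simp [N, Submodule.mem_smul_pointwise_iff_exists]
  have hg : Function.Surjective (lcMap (maximalIdeal R) d g) :=
    lcMap_surjective hM.le (LinearMap.surjective_rangeRestrict _)
  obtain ⟨δ, h₁, -, -⟩ := lc_exact (maximalIdeal R) d N.injective_subtype N.mkQ_surjective
    (LinearMap.exact_subtype_mkQ N)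
  have hlt : Module.supportDim R (M ⧸ N) < d := by
    rw [hN]
    exact supportDim_quotSMulTop_lt hM hx
  obtain ⟨w, hw⟩ := (h₁ z).1 (lc_eq_zero_of_supportDim_lt d hlt _)
  obtain ⟨y, rfl⟩ := hg w
  refine ⟨y, ?_⟩
  rw [← hw, ← lcMap_comp, ← lcMap_lsmul]
  rfl

end Local
end LocalCoh

namespace LocalCoh

section Local

variable {R : Type} [CommRing R]

lemma eq_natCast_of_lt_of_le {s : WithBot ℕ∞} {i : ℕ} (h : s < ((i + 1 : ℕ) : WithBot ℕ∞))
    (h' : ((i + 1 : ℕ) : WithBot ℕ∞) ≤ s + 1) : s = (i : WithBot ℕ∞) := by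
  apply eq_natCast_of_add_one_eq
  refine le_antisymm ?_ h'
  induction s using WithBot.recBotCoe with
  | bot => simp
  | coe s =>
    have : s < ((i + 1 : ℕ) : ℕ∞) := by exact_mod_cast h
    have := Order.add_one_le_of_lt this
    exact_mod_cast this

/-- The primes of dimension `d` in the support of a module. -/
def assh (M : Type) [AddCommGroup M] [Module R M] (d : ℕ) : Set (Ideal R) :=
  {p | ∃ h : p.IsPrime, ⟨p, h⟩ ∈ Module.support R M ∧ ringKrullDim (R ⧸ p) = d}

lemma ne_maximalIdeal_of_mem_assh [IsLocalRing R] {M : Type} [AddCommGroup M] [Module R M] {d : ℕ}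
    {p : Ideal R} (hp : p ∈ assh M (d + 1)) : p ≠ maximalIdeal R := by
  rintro rfl
  obtain ⟨_, _, h⟩ := hp
  let := Ideal.Quotient.field (maximalIdeal R)
  rw [ringKrullDim_eq_zero_of_field] at h
  have : 0 = d + 1 := by exact_mod_cast h
  omega

variable {M : Type} [AddCommGroup M] [Module R M] [Module.Finite R M]

lemma mem_minimalPrimes_of_mem_assh {d : ℕ} (hM : Module.supportDim R M = d) {p : Ideal R}
    (hp : p ∈ assh M d) : p ∈ (Module.annihilator R M).minimalPrimes := by
  obtain ⟨h, hs, hd⟩ := hp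
  exact mem_minimalPrimes_of_ringKrullDim_eq (q := ⟨p, h⟩) hs hM hd

variable [IsNoetherianRing R]

lemma finite_assh {d : ℕ} (hM : Module.supportDim R M = d) : (assh (R := R) M d).Finite :=
  (Ideal.finite_minimalPrimes_of_isNoetherianRing R _).subset fun _ ↦
    mem_minimalPrimes_of_mem_assh hM

lemma assh_eq {d : ℕ} (hM : Module.supportDim R M = d) :
    assh M d = {p ∈ associatedPrimes R M | ringKrullDim (R ⧸ p) = (d : WithBot ℕ∞)} := by
  ext p
  refine ⟨fun hp ↦ ⟨?_, hp.2.2⟩, fun ⟨hp, hpd⟩ ↦ ⟨hp.isPrime, ?_, hpd⟩⟩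
  · exact Module.associatedPrimes.minimalPrimes_annihilator_subset_associatedPrimes R M
      (mem_minimalPrimes_of_mem_assh hM hp)
  · refine Module.mem_support_iff_of_finite.2 ?_
    simpa [Submodule.annihilator_top] using hp.annihilator_le

variable [IsLocalRing R]

lemma isTors_of_supportDim_eq_zero (hM : Module.supportDim R M = 0) :
    IsTors (maximalIdeal R) M := by
  have h : maximalIdeal R ≤ (Module.annihilator R M).radical := by
    rw [Ideal.radical_eq_sInf]
    refine le_sInf fun p ⟨hp, hp'⟩ ↦ ?_
    have : (⟨p, hp'⟩ : PrimeSpectrum R) ∈ Module.support R M :=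
      Module.mem_support_iff_of_finite.2 hp
    rw [support_of_supportDim_eq_zero (R := R) M hM] at this
    exact this
  obtain ⟨t, ht⟩ := Ideal.exists_pow_le_of_le_radical_of_fg h (Ideal.fg_of_isNoetherianRing _)
  exact fun a ↦ ⟨t, fun r hr ↦ Module.mem_annihilator.1 (ht hr) a⟩

/-- Grothendieck's non-vanishing theorem. -/
theorem exists_lc_ne_zero (d : ℕ) :
    ∀ (M : Type) [AddCommGroup M] [Module R M] [Module.Finite R M],
      Module.supportDim R M = d → ∃ z : lc (maximalIdeal R) d M, z ≠ 0 := by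
  induction d with
  | zero =>
    intro M _ _ _ hM
    have : Nontrivial M := (Module.supportDim_ne_bot_iff_nontrivial R M).1 (by
      rw [hM]; exact WithBot.coe_ne_bot)
    obtain ⟨a, ha⟩ := exists_ne (0 : M)
    obtain ⟨t, ht⟩ := isTors_of_supportDim_eq_zero hM a
    obtain ⟨z, hz⟩ := exists_lcEv _ ht
    refine ⟨z, ?_⟩
    rintro rfl
    exact ha (by rw [← hz, map_zero])
  | succ d ih =>
    intro M _ _ _ hM
    by_contra! h0
    have := isArtinian_lc (R := R) d M
    obtain ⟨x, hx, hxp, n, hn⟩ := exists_pow_smul_mem_range (A := lc (maximalIdeal R) d M)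
      (finite_assh hM) (fun p hp ↦ hp.1) fun p ↦ ne_maximalIdeal_of_mem_assh
    have hdim : Module.supportDim R (QuotSMulTop x M) = d :=
      eq_natCast_of_lt_of_le (supportDim_quotSMulTop_lt hM fun p hp hpd ↦ hxp _ ⟨p.2, hp, hpd⟩)
        (hM ▸ Module.supportDim_le_supportDim_quotSMulTop_succ hx)
    let N := x • (⊤ : Submodule R M)
    have hsurj : Function.Surjective (lcMap (maximalIdeal R) d N.mkQ) := by
      obtain ⟨δ, -, h₂, -⟩ := lc_exact (maximalIdeal R) d N.injective_subtype N.mkQ_surjective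
        (LinearMap.exact_subtype_mkQ N)
      let g : M →ₗ[R] N := (LinearMap.lsmul R M x).codRestrict N fun a ↦
        (Submodule.mem_smul_pointwise_iff_exists _ _ _).2 ⟨a, trivial, rfl⟩
      have hg : Function.Surjective g := by
        rintro ⟨b, hb⟩
        obtain ⟨a, -, rfl⟩ := (Submodule.mem_smul_pointwise_iff_exists _ _ _).1 hb
        exact ⟨a, rfl⟩
      intro z
      refine (h₂ z).1 ?_
      obtain ⟨w, hw⟩ := lcMap_surjective hM.le hg (δ z)
      rw [← hw, h0 w, map_zero]
    cases d with
    | zero =>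
      have htop : (⊤ : Submodule R M) ≤ gam (maximalIdeal R) M := by
        refine Submodule.le_of_le_smul_of_le_jacobson_bot Module.Finite.fg_top
          (maximalIdeal_le_jacobson _) fun a _ ↦ ?_
        obtain ⟨t, ht⟩ := isTors_of_supportDim_eq_zero hdim (N.mkQ a)
        obtain ⟨z, hz⟩ := exists_lcEv _ ht
        obtain ⟨w, rfl⟩ := hsurj z
        rw [lcEv_map, ← sub_eq_zero, ← map_sub, Submodule.mkQ_apply,
          Submodule.Quotient.mk_eq_zero] at hz
        obtain ⟨c, -, hc⟩ := (Submodule.mem_smul_pointwise_iff_exists _ _ _).1 hz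
        refine Submodule.mem_sup.2 ⟨lcEv (maximalIdeal R) M w, ?_, -(x • c),
          neg_mem (Submodule.smul_mem_smul hx trivial), by rw [hc]; abel⟩
        obtain ⟨t, ht⟩ := lc_torsion (maximalIdeal R) 0 w
        exact ⟨t, fun r hr ↦ by rw [← map_smul, ht r hr, map_zero]⟩
      have htors : IsTors (maximalIdeal R) M := fun a ↦ htop (Submodule.mem_top (x := a))
      obtain ⟨t, ht⟩ := htors.exists_pow
      obtain ⟨p, hp, hpd⟩ := exists_mem_support_ringKrullDim_eq hM
      refine ne_maximalIdeal_of_mem_assh (M := M) (d := 0) ⟨p.2, hp, hpd⟩ ?_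
      refine (le_maximalIdeal p.2.ne_top).antisymm (p.2.le_of_pow_le (n := t) fun r hr ↦ ?_)
      exact Module.mem_support_iff_of_finite.1 hp
        (Module.mem_annihilator.2 fun a ↦ ht a r hr)
    | succ d =>
      obtain ⟨z, hz⟩ := ih (QuotSMulTop x M) hdim
      obtain ⟨y, hy, hyp⟩ := exists_mem_forall_notMem (I := maximalIdeal R) (finite_assh hdim)
        (fun p hp ↦ hp.1) fun p hp hle ↦ ne_maximalIdeal_of_mem_assh hp
          ((le_maximalIdeal hp.1.ne_top).antisymm hle)
      have hpow (k : ℕ) : ∃ w : lc (maximalIdeal R) (d + 1) (QuotSMulTop x M), y ^ k • w = z := by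
        induction k with
        | zero => exact ⟨z, by simp⟩
        | succ k ihk =>
          obtain ⟨w, hw⟩ := ihk
          obtain ⟨v, hv⟩ := exists_smul_eq hdim (x := y)
            (fun p hp hpd ↦ hyp _ ⟨p.2, hp, hpd⟩) w
          exact ⟨v, by rw [pow_succ, mul_smul, hv, hw]⟩
      obtain ⟨w, hw⟩ := hpow n
      obtain ⟨a, rfl⟩ := hsurj w
      obtain ⟨b, hb⟩ := hn a _ (Ideal.pow_mem_pow hy n)
      refine hz ?_
      rw [← hw, ← map_smul, ← hb, map_smul]
      refine lc_smul_eq_zero _ _ (fun c ↦ ?_) _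
      obtain ⟨c, rfl⟩ := Submodule.mkQ_surjective _ c
      rw [← map_smul, Submodule.mkQ_apply, Submodule.Quotient.mk_eq_zero]
      exact (Submodule.mem_smul_pointwise_iff_exists _ _ _).2 ⟨c, trivial, rfl⟩

end Local

section Matlis

variable {R : Type} [CommRing R] {W E : Type} [AddCommGroup W] [Module R W]
  [AddCommGroup E] [Module R E] [hE : Module.Injective R E]

/-- Homomorphisms to an injective module containing the residue field detect elements. -/
lemma exists_apply_ne_zero [IsLocalRing R] {f : (R ⧸ maximalIdeal R) →ₗ[R] E}
    (hf : Function.Injective f) {a : W} (ha : a ≠ 0) : ∃ φ : W →ₗ[R] E, φ a ≠ 0 := by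
  let s := LinearMap.toSpanSingleton R W a
  have hs : LinearMap.ker s ≤ maximalIdeal R :=
    le_maximalIdeal fun h ↦ ha (by
      have : (1 : R) ∈ LinearMap.ker s := h ▸ Submodule.mem_top
      simpa [s] using this)
  obtain ⟨φ, hφ⟩ := hE.out ((LinearMap.ker s).liftQ s le_rfl)
    (LinearMap.ker_eq_bot.1 (Submodule.ker_liftQ_eq_bot _ _ _ le_rfl))
    (f ∘ₗ Submodule.mapQ _ _ LinearMap.id hs)
  refine ⟨φ, fun h ↦ ?_⟩
  have h1 := hφ (Submodule.Quotient.mk 1)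
  rw [Submodule.liftQ_apply, LinearMap.toSpanSingleton_apply, one_smul, h] at h1
  have h2 : (Submodule.Quotient.mk 1 : R ⧸ maximalIdeal R) = 0 :=
    hf (h1.symm.trans (map_zero f).symm)
  rw [Submodule.Quotient.mk_eq_zero] at h2
  exact (Ideal.ne_top_iff_one _).1 (maximalIdeal.isMaximal R).ne_top h2

/-- If no nonzero element is killed by all of `s`, then `s` generates the dual. -/
lemma exists_eq_sum_smul (s : Finset R) (h : ∀ a : W, (∀ r ∈ s, r • a = 0) → a = 0)
    (φ : W →ₗ[R] E) : ∃ ψ : s → (W →ₗ[R] E), φ = ∑ r : s, (r : R) • ψ r := by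
  classical
  obtain ⟨Φ, hΦ⟩ := hE.out (LinearMap.pi fun r : s ↦ LinearMap.lsmul R W (r : R))
    ((injective_iff_map_eq_zero _).2 fun a ha ↦ h a fun r hr ↦ congrFun ha ⟨r, hr⟩) φ
  refine ⟨fun r ↦ Φ ∘ₗ LinearMap.single R (fun _ : s ↦ W) r, LinearMap.ext fun a ↦ ?_⟩
  rw [← hΦ a, LinearMap.sum_apply, ← LinearMap.sum_single_apply (φ := fun _ : s ↦ W)
    ((LinearMap.pi fun r : s ↦ LinearMap.lsmul R W (r : R)) a), map_sum]
  refine Finset.sum_congr rfl fun r _ ↦ ?_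
  simp [← map_smul, ← Pi.single_smul]

end Matlis

end LocalCoh

namespace LocalCoh

section Canonical

variable {R : Type} [CommRing R] [IsLocalRing R]
  {M W E : Type} [AddCommGroup M] [Module R M] [AddCommGroup W] [Module R W]
  [AddCommGroup E] [Module R E] [Module.Injective R E] {d : ℕ}

lemma annihilator_le_of_dual_equiv {f : (R ⧸ maximalIdeal R) →ₗ[R] E}
    (hf : Function.Injective f) (e : (W →ₗ[R] E) ≃ₗ[R] lc (maximalIdeal R) d M) :
    Module.annihilator R M ≤ Module.annihilator R W := by
  refine fun r hr ↦ Module.mem_annihilator.2 fun a ↦ ?_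
  by_contra ha
  obtain ⟨φ, hφ⟩ := exists_apply_ne_zero hf ha
  refine hφ ?_
  have h : r • φ = 0 := e.injective (by
    rw [map_smul, map_zero, lc_smul_eq_zero _ _ (Module.mem_annihilator.1 hr)])
  rw [map_smul, ← LinearMap.smul_apply, h, LinearMap.zero_apply]

variable [Module.Finite R M]

lemma support_subset_of_dual_equiv [Module.Finite R W] {f : (R ⧸ maximalIdeal R) →ₗ[R] E}
    (hf : Function.Injective f) (e : (W →ₗ[R] E) ≃ₗ[R] lc (maximalIdeal R) d M) :
    Module.support R W ⊆ Module.support R M := fun _ hp ↦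
  Module.mem_support_iff_of_finite.2
    ((annihilator_le_of_dual_equiv hf e).trans (Module.mem_support_iff_of_finite.1 hp))

variable [IsNoetherianRing R]

lemma smul_ne_zero_of_forall_notMem_assh (hM : Module.supportDim R M = d)
    {f : (R ⧸ maximalIdeal R) →ₗ[R] E} (hf : Function.Injective f)
    (e : (W →ₗ[R] E) ≃ₗ[R] lc (maximalIdeal R) d M) {x : R} (hx : ∀ p ∈ assh M d, x ∉ p)
    {a : W} (ha : a ≠ 0) : x • a ≠ 0 := by
  intro h
  obtain ⟨φ, hφ⟩ := exists_apply_ne_zero hf ha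
  obtain ⟨y, hy⟩ := exists_smul_eq hM (x := x) (fun p hp hpd ↦ hx _ ⟨p.2, hp, hpd⟩) (e φ)
  obtain ⟨ψ, rfl⟩ := e.surjective y
  rw [← map_smul] at hy
  rw [← e.injective hy, LinearMap.smul_apply, ← map_smul, h, map_zero] at hφ
  exact hφ rfl

lemma exists_ne_zero_forall_smul_eq_zero (hM : Module.supportDim R M = d)
    (e : (W →ₗ[R] E) ≃ₗ[R] lc (maximalIdeal R) d M) {p : Ideal R} (hp : p ∈ assh M d) :
    ∃ a : W, a ≠ 0 ∧ ∀ r ∈ p, r • a = 0 := by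
  by_contra! h
  obtain ⟨s, rfl⟩ := p.fg_of_isNoetherianRing
  obtain ⟨hprime, hps, hpd⟩ := hp
  let p := Ideal.span (s : Set R)
  have hdim : Module.supportDim R (M ⧸ p • (⊤ : Submodule R M)) = d := by
    rw [← hpd, ringKrullDim_quotient, Module.supportDim, Module.support_quotient,
      Set.inter_eq_right.2]
    exact fun q hq ↦ Module.mem_support_mono (p := ⟨_, hprime⟩) hq hps
  obtain ⟨z, hz⟩ := exists_lc_ne_zero d _ hdim
  obtain ⟨w, rfl⟩ := lcMap_surjective hM.le (p • (⊤ : Submodule R M)).mkQ_surjective z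
  obtain ⟨φ, rfl⟩ := e.surjective w
  obtain ⟨ψ, rfl⟩ := exists_eq_sum_smul s (fun a ha ↦ by
    by_contra ha'
    obtain ⟨r, hr, hra⟩ := h a ha'
    have : p ≤ LinearMap.ker (LinearMap.toSpanSingleton R W a) := Ideal.span_le.2 ha
    exact hra (this hr)) φ
  refine hz ?_
  simp only [map_sum, map_smul]
  refine Finset.sum_eq_zero fun r _ ↦ lc_smul_eq_zero _ _ (fun b ↦ ?_) _
  obtain ⟨b, rfl⟩ := Submodule.mkQ_surjective _ b
  rw [← map_smul, Submodule.mkQ_apply, Submodule.Quotient.mk_eq_zero]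
  exact Submodule.smul_mem_smul (Ideal.subset_span r.2) trivial

lemma mem_assh_of_isAssociatedPrime [Module.Finite R W] (hM : Module.supportDim R M = d)
    {f : (R ⧸ maximalIdeal R) →ₗ[R] E} (hf : Function.Injective f)
    (e : (W →ₗ[R] E) ≃ₗ[R] lc (maximalIdeal R) d M) {p : Ideal R}
    (hp : IsAssociatedPrime p W) : p ∈ assh M d := by
  have hprime := hp.isPrime
  have hps : (⟨p, hprime⟩ : PrimeSpectrum R) ∈ Module.support R M := by
    refine support_subset_of_dual_equiv hf e (Module.mem_support_iff_of_finite.2 ?_)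
    simpa [Submodule.annihilator_top] using hp.annihilator_le
  obtain ⟨-, a, rfl⟩ := isAssociatedPrime_iff.1 hp
  by_contra hpa
  obtain ⟨x, hx, hxq⟩ := exists_mem_forall_notMem (I := (⊥ : Submodule R W).colon {a})
    (finite_assh hM) (fun q hq ↦ hq.1) fun q hq hle ↦ hpa (by
      have := eq_of_le_of_ringKrullDim_eq (q := ⟨q, hq.1⟩) hps hM hle hq.2.2
      rwa [show (⊥ : Submodule R W).colon {a} = q from congrArg PrimeSpectrum.asIdeal this])
  refine smul_ne_zero_of_forall_notMem_assh hM hf e hxq (a := a) ?_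
    (by simpa [Submodule.mem_colon_singleton] using hx)
  rintro rfl
  exact hprime.ne_top ((Ideal.eq_top_iff_one _).2 (by simp [Submodule.mem_colon_singleton]))

lemma associatedPrimes_eq_assh [Module.Finite R W] (hM : Module.supportDim R M = d)
    {f : (R ⧸ maximalIdeal R) →ₗ[R] E} (hf : Function.Injective f)
    (e : (W →ₗ[R] E) ≃ₗ[R] lc (maximalIdeal R) d M) : associatedPrimes R W = assh M d := by
  refine Set.Subset.antisymm (fun p hp ↦ mem_assh_of_isAssociatedPrime hM hf e hp) fun p hp ↦ ?_
  obtain ⟨a, ha, hpa⟩ := exists_ne_zero_forall_smul_eq_zero hM e hp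
  obtain ⟨q, hq, hle⟩ := exists_le_isAssociatedPrime_of_isNoetherianRing R a ha
  have hq' := mem_assh_of_isAssociatedPrime hM hf e hq
  have := eq_of_le_of_ringKrullDim_eq (p := ⟨p, hp.1⟩) (q := ⟨q, hq'.1⟩) hp.2.1 hM
    (show p ≤ q from le_trans (fun r hr ↦ Submodule.mem_colon_singleton.2 (hpa r hr)) hle) hq'.2.2
  rwa [show p = q from congrArg PrimeSpectrum.asIdeal this]

lemma supportDim_eq_of_dual_equiv [Module.Finite R W] (hM : Module.supportDim R M = d)
    {f : (R ⧸ maximalIdeal R) →ₗ[R] E} (hf : Function.Injective f)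
    (e : (W →ₗ[R] E) ≃ₗ[R] lc (maximalIdeal R) d M) :
    Module.supportDim R W = Module.supportDim R M := by
  refine le_antisymm (Order.krullDim_le_of_strictMono
    (Set.inclusion (support_subset_of_dual_equiv hf e)) fun _ _ h ↦ h) ?_
  obtain ⟨p, hp, hpd⟩ := exists_mem_support_ringKrullDim_eq hM
  have hpW : p.asIdeal ∈ associatedPrimes R W :=
    associatedPrimes_eq_assh hM hf e ▸ ⟨p.2, hp, hpd⟩
  rw [hM, ← hpd]
  refine ringKrullDim_quotient_le_supportDim (Module.mem_support_iff_of_finite.2 ?_)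
  simpa [Submodule.annihilator_top] using IsAssociatedPrime.annihilator_le hpW

end Canonical

end LocalCoh

end

theorem stmt1 (R : Type) [CommRing R] [IsNoetherianRing R] [IsLocalRing R]
    (d' : ℕ) (M ω : ModuleCat R) (hM : Module.Finite R ↥M)
    (hdim : mdim R ↥M = (d' : WithBot ℕ∞))
    (hω : IsCanonicalModule R (maximalIdeal R) d' M ω) :
    associatedPrimes R ↥ω =
      {p ∈ associatedPrimes R ↥M | ringKrullDim (R ⧸ p) = (d' : WithBot ℕ∞)} ∧
    mdim R ↥ω = mdim R ↥M ∧ Module.support R ↥ω ⊆ Module.support R ↥M := by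
  obtain ⟨hfin, E, ⟨hinj, f, hf, -⟩, ⟨e⟩⟩ := hω
  let e' : (↥ω →ₗ[R] ↥E) ≃ₗ[R] LocalCoh.lc (maximalIdeal R) d' ↥M :=
    e.trans (LocalCoh.H.equivLC (maximalIdeal R) d' M).symm
  exact ⟨(LocalCoh.associatedPrimes_eq_assh hdim hf e').trans (LocalCoh.assh_eq hdim),
    LocalCoh.supportDim_eq_of_dual_equiv hdim hf e',
    LocalCoh.support_subset_of_dual_equiv hf e'⟩
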